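/- Let D_n denote the number of quarter-plane walks of length n with steps from 𝒟 = {(−1,1),(0,1),(1,−1)}, and let D(t) = Σ_{n≥0} D_n t^n be the associated formal power series over ℚ. Then D(t) is not D-finite: there do not exist a natural number r and polynomials p_0,…,p_r ∈ ℚ[t], not all zero, such that Σ_{i=0}^r p_i(t)·D^{(i)}(t) = 0 as formal power series. -/

import Mathlib

/-- The number of quarter-plane walks of length `n` with steps from `S`:
sequences of `n` steps, each in `S`, all of whose partial sums have both
coordinates nonnegative. -/
noncomputable def quarterPlaneWalks (S : Finset (ℤ × ℤ)) (n : ℕ) : ℕ :=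
  Nat.card {f : Fin n → ℤ × ℤ //
    (∀ k, f k ∈ S) ∧
    ∀ k : Fin n, 0 ≤ ∑ j ∈ Finset.Iic k, (f j).1 ∧ 0 ≤ ∑ j ∈ Finset.Iic k, (f j).2}

/-- The counting generating function of quarter-plane walks with steps
from `S`, as a formal power series over ℚ. -/
noncomputable def walkGF (S : Finset (ℤ × ℤ)) : PowerSeries ℚ :=
  PowerSeries.mk fun n => (quarterPlaneWalks S n : ℚ)

set_option linter.deprecated false
open Filter Topology


/-- Derivation with respect to `T`. -/
noncomputable def qpDelta (T G : ℂ → ℂ) : ℂ → ℂ := fun z => deriv G z / deriv T z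

theorem qpDelta_mero {T G : ℂ → ℂ} {z : ℂ} (hT : MeromorphicAt T z) (hG : MeromorphicAt G z) (i : ℕ) :
    MeromorphicAt ((qpDelta T)^[i] G) z := by
  induction i with
  | zero => simpa using hG
  | succ n ih =>
    rw [Function.iterate_succ', Function.comp_apply]
    exact ih.deriv.div hT.deriv

theorem qpDelta_order {T G : ℂ → ℂ} {z : ℂ} {m : ℤ} (hT : AnalyticAt ℂ T z) (hT' : deriv T z ≠ 0)
    (hm : m < 0) (hG : meromorphicOrderAt G z = m) (i : ℕ) :
    meromorphicOrderAt ((qpDelta T)^[i] G) z = ((m - i : ℤ) : WithTop ℤ) := by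
  have hGm : MeromorphicAt G z := meromorphicAt_of_meromorphicOrderAt_ne_zero (by
    rw [hG]; exact_mod_cast hm.ne)
  induction i with
  | zero => simpa using hG
  | succ n ih =>
    rw [Function.iterate_succ', Function.comp_apply]
    have h1 : meromorphicOrderAt (deriv ((qpDelta T)^[n] G)) z = ((m - n - 1 : ℤ) : WithTop ℤ) := by
      apply meromorphicOrderAt_deriv_eq_sub_one _ ih
      have : m - n ≠ 0 := by omega
      exact_mod_cast this
    have h2 : qpDelta T ((qpDelta T)^[n] G) = (deriv T)⁻¹ * deriv ((qpDelta T)^[n] G) := by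
      ext z; simp [qpDelta, div_eq_inv_mul]
    rw [h2, meromorphicOrderAt_mul_of_ne_zero (hT.deriv.inv hT') (inv_ne_zero hT'), h1]
    congr 1; push_cast; ring

theorem qpDelta_comp {T G f : ℂ → ℂ} {z : ℂ} (hT : AnalyticAt ℂ T z) (hT' : deriv T z ≠ 0)
    (hf : AnalyticAt ℂ f (T z)) (hG : G =ᶠ[𝓝 z] f ∘ T) (i : ℕ) :
    (qpDelta T)^[i] G =ᶠ[𝓝 z] (deriv^[i] f) ∘ T := by
  induction i with
  | zero => simpa using hG
  | succ n ih =>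
    rw [Function.iterate_succ', Function.comp_apply, Function.iterate_succ', Function.comp_apply]
    have h0 : AnalyticAt ℂ (deriv^[n] f) (T z) := hf.iterated_deriv n
    have h1 : ∀ᶠ w in 𝓝 z, deriv T w ≠ 0 := hT.deriv.continuousAt.eventually_ne hT'
    have h2 : ∀ᶠ w in 𝓝 z, AnalyticAt ℂ (deriv^[n] f) (T w) :=
      hT.continuousAt.eventually h0.eventually_analyticAt
    filter_upwards [ih.deriv, h1, h2, hT.eventually_analyticAt] with w e1 e2 e3 e4
    simp only [qpDelta, Function.comp_apply]
    rw [e1, deriv_comp _ e3.differentiableAt e4.differentiableAt]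
    field_simp

theorem qp_abstract (f : ℂ → ℂ) (hf : AnalyticOnNhd ℂ f (Metric.ball 0 (1/3)))
    (r : ℕ) (p : ℕ → Polynomial ℚ) (hr : p r ≠ 0)
    (hode : ∀ z ∈ Metric.ball (0:ℂ) (1/3),
      ∑ i ∈ Finset.range (r+1), Polynomial.aeval z (p i) * deriv^[i] f z = 0)
    (T G : ℂ → ℂ) (U : Set ℂ) (hU : IsPreconnected U) (hG : MeromorphicOn G U)
    (hT : AnalyticOnNhd ℂ T U) (k0 : ℂ) (hk0 : k0 ∈ U) (hTk : T k0 ∈ Metric.ball (0:ℂ) (1/3))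
    (hTk' : deriv T k0 ≠ 0) (hGk : G =ᶠ[𝓝 k0] f ∘ T)
    (P : Set ℂ) (hP : P ⊆ U) (hP1 : ∀ z ∈ P, deriv T z ≠ 0)
    (hP2 : ∀ z ∈ P, meromorphicOrderAt G z < 0) (hP3 : (Set.image T P).Infinite) : False := by
  set H : ℂ → ℂ := fun z => ∑ i ∈ Finset.range (r+1), Polynomial.aeval (T z) (p i) * (qpDelta T)^[i] G z with hH
  have hpa : ∀ i, ∀ z ∈ U, AnalyticAt ℂ (fun z => Polynomial.aeval (T z) (p i)) z := fun i z hz =>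
    AnalyticAt.aeval_polynomial (hT z hz) (p i)
  have hterm : ∀ i, ∀ z ∈ U, MeromorphicAt (fun z => Polynomial.aeval (T z) (p i) * (qpDelta T)^[i] G z) z :=
    fun i z hz => (hpa i z hz).meromorphicAt.mul (qpDelta_mero (hT z hz).meromorphicAt (hG z hz) i)
  have hHm : MeromorphicOn H U := fun z hz => by
    apply MeromorphicAt.fun_sum
    intro i _; exact hterm i z hz
  have hHk : meromorphicOrderAt H k0 = ⊤ := by
    rw [meromorphicOrderAt_eq_top_iff]
    apply Filter.Eventually.filter_mono nhdsWithin_le_nhds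
    have h1 : ∀ᶠ z in 𝓝 k0, ∀ i ∈ Finset.range (r+1), (qpDelta T)^[i] G z = ((deriv^[i] f) ∘ T) z := by
      rw [Filter.eventually_all_finset]
      intro i _
      exact qpDelta_comp (hT k0 hk0) hTk' (hf _ hTk) hGk i
    have h2 : ∀ᶠ z in 𝓝 k0, T z ∈ Metric.ball (0:ℂ) (1/3) :=
      (hT k0 hk0).continuousAt.eventually (Metric.isOpen_ball.mem_nhds hTk)
    filter_upwards [h1, h2] with z e1 e2
    rw [← hode _ e2]
    apply Finset.sum_congr rfl
    intro i hi
    rw [e1 i hi]; rfl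
  -- pick a good pole
  have hex : ∃ z ∈ P, Polynomial.aeval (T z) (p r) ≠ 0 := by
    by_contra! hcon
    apply hr
    have : (p r).map (algebraMap ℚ ℂ) = 0 := by
      apply Polynomial.eq_zero_of_infinite_isRoot
      apply hP3.mono
      rintro _ ⟨z, hz, rfl⟩
      have := hcon z hz
      simpa [Polynomial.IsRoot, Polynomial.eval_map_algebraMap] using this
    exact (Polynomial.map_eq_zero _).1 this
  obtain ⟨z, hz, hzp⟩ := hex
  obtain ⟨m, hm⟩ : ∃ m : ℤ, meromorphicOrderAt G z = m := by
    have := (hP2 z hz).ne_top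
    exact ⟨_, (WithTop.coe_untop _ this).symm⟩
  have hm0 : m < 0 := by have := hP2 z hz; rw [hm] at this; exact_mod_cast this
  have hzU := hP hz
  have hord := qpDelta_order (hT z hzU) (hP1 z hz) hm0 hm
  have hlow : ∀ n : ℕ, n ≤ r → (((m - r : ℤ) : WithTop ℤ)) <
      meromorphicOrderAt (fun w => ∑ i ∈ Finset.range n, Polynomial.aeval (T w) (p i) * (qpDelta T)^[i] G w) z := by
    intro n
    induction n with
    | zero => 
      intro _
      simp only [Finset.range_zero, Finset.sum_empty]
      rw [meromorphicOrderAt_eq_top_iff.2 (by simp)]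
      exact WithTop.coe_lt_top _
    | succ n ih =>
      intro hn
      simp only [Finset.sum_range_succ]
      refine lt_of_lt_of_le (lt_min (ih (by omega)) ?_) (meromorphicOrderAt_add ?_ (hterm n z hzU))
      · rw [fun_meromorphicOrderAt_mul (hpa n z hzU).meromorphicAt
          (qpDelta_mero (hT z hzU).meromorphicAt (hG z hzU) n), hord n]
        have h0 := (hpa n z hzU).meromorphicOrderAt_nonneg
        calc (((m - r : ℤ) : WithTop ℤ)) < ((m - n : ℤ) : WithTop ℤ) := by
              exact_mod_cast (by omega : m - (r:ℤ) < m - n)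
          _ = 0 + ((m - n : ℤ) : WithTop ℤ) := by simp
          _ ≤ _ := by gcongr
      · apply MeromorphicAt.fun_sum
        intro i _; exact hterm i z hzU
  have htop : meromorphicOrderAt (fun w => Polynomial.aeval (T w) (p r) * (qpDelta T)^[r] G w) z
      = ((m - r : ℤ) : WithTop ℤ) := by
    rw [← hord r]
    exact meromorphicOrderAt_mul_of_ne_zero (hpa r z hzU) hzp
  have hHz : meromorphicOrderAt H z = ((m - r : ℤ) : WithTop ℤ) := by
    have : H = (fun w => ∑ i ∈ Finset.range r, Polynomial.aeval (T w) (p i) * (qpDelta T)^[i] G w) +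
      (fun w => Polynomial.aeval (T w) (p r) * (qpDelta T)^[r] G w) := by
      ext w; simp [hH, Finset.sum_range_succ]
    rw [this, meromorphicOrderAt_add_eq_right_of_lt, htop]
    · apply MeromorphicAt.fun_sum
      intro i _; exact hterm i z hzU
    · rw [htop]; exact hlow r le_rfl
  have := hHm.meromorphicOrderAt_ne_top_of_isPreconnected hU hzU hk0 (by rw [hHz]; exact WithTop.coe_ne_top)
  exact this hHk

/-- Evaluation of a rational power series at a complex number. -/
noncomputable def qpEv (F : PowerSeries ℚ) (z : ℂ) : ℂ := ∑' n, ((PowerSeries.coeff n F : ℚ) : ℂ) * z ^ n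

/-- Absolute convergence in the disc of radius `1/3`. -/
def qpGood (F : PowerSeries ℚ) : Prop :=
  ∀ z ∈ Metric.ball (0:ℂ) (1/3), Summable fun n => ‖((PowerSeries.coeff n F : ℚ) : ℂ) * z ^ n‖

theorem qpGood_diff {F : PowerSeries ℚ} (hF : qpGood F) {z : ℂ} (hz : z ∈ Metric.ball (0:ℂ) (1/3)) :
    HasSum (fun n : ℕ => ((PowerSeries.coeff n F.derivativeFun : ℚ) : ℂ) * z ^ n) (deriv (qpEv F) z)
    ∧ AnalyticAt ℂ (qpEv F) z := by
  simp only [Metric.mem_ball, dist_zero_right] at hz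
  obtain ⟨ρ, h1, h2⟩ := exists_between hz
  have hρ : 0 ≤ ρ := (norm_nonneg z).trans h1.le
  have hu : Summable fun n => ‖((PowerSeries.coeff n F : ℚ) : ℂ) * (ρ:ℂ) ^ n‖ := hF ρ (by
    simp [abs_of_nonneg hρ]; simpa using h2)
  have hle : ∀ (i : ℕ) (w : ℂ), w ∈ Metric.ball (0:ℂ) ρ → ‖((PowerSeries.coeff i F : ℚ) : ℂ) * w ^ i‖ ≤ ‖((PowerSeries.coeff i F : ℚ) : ℂ) * (ρ:ℂ) ^ i‖ := by
    intro i w hw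
    simp only [Metric.mem_ball, dist_zero_right] at hw
    simp only [norm_mul, norm_pow, Complex.norm_real, Real.norm_eq_abs, abs_of_nonneg hρ]
    gcongr
  have hd : ∀ i : ℕ, DifferentiableOn ℂ (fun w : ℂ => ((PowerSeries.coeff i F : ℚ) : ℂ) * w ^ i) (Metric.ball (0:ℂ) ρ) := by
    intro i; fun_prop
  have hzb : z ∈ Metric.ball (0:ℂ) ρ := by simpa using h1
  constructor
  · have h := Complex.hasSum_deriv_of_summable_norm hu hd Metric.isOpen_ball hle hzb
    rw [← hasSum_nat_add_iff' 1] at h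
    simp only [Finset.range_one, Finset.sum_singleton, pow_zero, mul_one, deriv_const, sub_zero] at h
    have e : ∀ n : ℕ, ((PowerSeries.coeff n F.derivativeFun : ℚ) : ℂ) * z ^ n =
        deriv (fun w => ((PowerSeries.coeff (n + 1) F : ℚ) : ℂ) * w ^ (n + 1)) z := by
      intro n
      have : PowerSeries.coeff n F.derivativeFun = PowerSeries.coeff (n + 1) F * (n + 1) :=
        PowerSeries.coeff_derivative F n
      rw [this]
      simp
      ring
    simp only [e]
    exact h
  · exact (Complex.differentiableOn_tsum_of_summable_norm hu hd Metric.isOpen_ball hle).analyticAt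
      (Metric.isOpen_ball.mem_nhds hzb)

theorem qpGood_deriv {F : PowerSeries ℚ} (hF : qpGood F) : qpGood F.derivativeFun :=
  fun _ hz => (qpGood_diff hF hz).1.summable.norm

theorem qpEv_deriv {F : PowerSeries ℚ} (hF : qpGood F) {z : ℂ} (hz : z ∈ Metric.ball (0:ℂ) (1/3)) :
    qpEv F.derivativeFun z = deriv (qpEv F) z := (qpGood_diff hF hz).1.tsum_eq

theorem qpGood_iter {F : PowerSeries ℚ} (hF : qpGood F) (i : ℕ) :
    qpGood (PowerSeries.derivativeFun^[i] F) ∧ ∀ z ∈ Metric.ball (0:ℂ) (1/3),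
      qpEv (PowerSeries.derivativeFun^[i] F) z = deriv^[i] (qpEv F) z := by
  induction i with
  | zero => exact ⟨hF, fun _ _ => rfl⟩
  | succ n ih =>
    simp only [Function.iterate_succ', Function.comp_apply]
    refine ⟨qpGood_deriv ih.1, fun z hz => ?_⟩
    rw [qpEv_deriv ih.1 hz]
    apply Filter.EventuallyEq.deriv_eq
    filter_upwards [Metric.isOpen_ball.mem_nhds hz] with w hw using ih.2 w hw

theorem qpEv_poly_mul {F : PowerSeries ℚ} (hF : qpGood F) (P : Polynomial ℚ) {z : ℂ} (hz : z ∈ Metric.ball (0:ℂ) (1/3)) :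
    HasSum (fun n => ((PowerSeries.coeff n ((P : PowerSeries ℚ) * F) : ℚ) : ℂ) * z ^ n)
      (Polynomial.aeval z P * qpEv F z) := by
  have hP : HasSum (fun n => ((PowerSeries.coeff n (P : PowerSeries ℚ) : ℚ) : ℂ) * z ^ n) (Polynomial.aeval z P) := by
    rw [Polynomial.aeval_eq_sum_range]
    have := hasSum_sum_of_ne_finset_zero (L := SummationFilter.unconditional ℕ) (f := fun n => ((PowerSeries.coeff n (P : PowerSeries ℚ) : ℚ) : ℂ) * z ^ n)
      (s := Finset.range (P.natDegree + 1)) (by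
      intro b hb
      have : P.coeff b = 0 := Polynomial.coeff_eq_zero_of_natDegree_lt (by simpa using hb)
      simp [this])
    convert this using 2 with n
    simp [Rat.smul_def]
  have e : ∀ n, ((PowerSeries.coeff n ((P : PowerSeries ℚ) * F) : ℚ) : ℂ) * z ^ n =
      ∑ kl ∈ Finset.HasAntidiagonal.antidiagonal n, (((PowerSeries.coeff kl.1 (P : PowerSeries ℚ) : ℚ) : ℂ) * z ^ kl.1) * (((PowerSeries.coeff kl.2 F : ℚ) : ℂ) * z ^ kl.2) := by
    intro n
    rw [PowerSeries.coeff_mul]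
    push_cast
    rw [Finset.sum_mul]
    apply Finset.sum_congr rfl
    intro kl hkl
    rw [Finset.HasAntidiagonal.mem_antidiagonal] at hkl
    rw [← hkl, pow_add]; ring
  simp only [e]
  have h1 := hP.summable.norm
  have h2 := hF z hz
  have h3 := tsum_mul_tsum_eq_tsum_sum_antidiagonal_of_summable_norm h1 h2
  rw [hP.tsum_eq] at h3
  unfold qpEv
  rw [h3]
  exact (summable_norm_sum_mul_antidiagonal_of_summable_norm h1 h2).of_norm.hasSum

theorem qp_ode {F : PowerSeries ℚ} (hF : qpGood F) (r : ℕ) (p : ℕ → Polynomial ℚ)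
    (h : ∑ i ∈ Finset.range (r + 1), (p i : PowerSeries ℚ) * (PowerSeries.derivativeFun^[i] F) = 0) :
    ∀ z ∈ Metric.ball (0:ℂ) (1/3),
      ∑ i ∈ Finset.range (r+1), Polynomial.aeval z (p i) * deriv^[i] (qpEv F) z = 0 := by
  intro z hz
  have h1 : HasSum (fun n => ∑ i ∈ Finset.range (r+1),
      ((PowerSeries.coeff n ((p i : PowerSeries ℚ) * (PowerSeries.derivativeFun^[i] F)) : ℚ) : ℂ) * z ^ n)
      (∑ i ∈ Finset.range (r+1), Polynomial.aeval z (p i) * deriv^[i] (qpEv F) z) := by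
    apply hasSum_sum
    intro i _
    rw [← (qpGood_iter hF i).2 z hz]
    exact qpEv_poly_mul (qpGood_iter hF i).1 (p i) hz
  have h2 : ∀ n, ∑ i ∈ Finset.range (r+1),
      ((PowerSeries.coeff n ((p i : PowerSeries ℚ) * (PowerSeries.derivativeFun^[i] F)) : ℚ) : ℂ) * z ^ n = 0 := by
    intro n
    rw [← Finset.sum_mul, ← Rat.cast_sum, ← map_sum, h]
    simp
  simp only [h2] at h1
  exact h1.unique hasSum_zero

theorem qpGood_of_le {F : PowerSeries ℚ} (hF : ∀ n, ‖((PowerSeries.coeff n F : ℚ) : ℂ)‖ ≤ 3 ^ n) : qpGood F := by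
  intro z hz
  simp only [Metric.mem_ball, dist_zero_right] at hz
  have : Summable fun n : ℕ => (3 * ‖z‖) ^ n := summable_geometric_of_lt_one (by positivity) (by linarith)
  refine this.of_nonneg_of_le (fun _ => norm_nonneg _) fun n => ?_
  rw [norm_mul, norm_pow, mul_pow]
  gcongr
  exact hF n

/-- Validity of a walk started at `a`. -/
def qpV (S : Finset (ℤ × ℤ)) (n : ℕ) (a : ℤ × ℤ) (f : Fin n → S) : Prop :=
  ∀ k : Fin n, 0 ≤ a.1 + ∑ j ∈ Finset.Iic k, (f j).1.1 ∧ 0 ≤ a.2 + ∑ j ∈ Finset.Iic k, (f j).1.2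

theorem qpV_cons (S : Finset (ℤ × ℤ)) (n : ℕ) (a : ℤ × ℤ) (s : S) (f : Fin n → S) :
    qpV S (n+1) a (Fin.cons s f : Fin (n+1) → S) ↔
      (0 ≤ a.1 + s.1.1 ∧ 0 ≤ a.2 + s.1.2) ∧ qpV S n (a + s.1) f := by
  have key : ∀ (m : ℕ) (h : Fin m → ℤ) (k : Fin m), ∑ j ∈ Finset.Iic k, h j = ∑ j, if j ≤ k then h j else 0 := by
    intro m h k
    rw [← Finset.sum_filter]
    congr 1
    ext j; simp
  unfold qpV
  simp only [key, Fin.forall_fin_succ, Fin.sum_univ_succ]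
  simp [add_assoc, Fin.succ_ne_zero]

/-- Number of walks started at `a`. -/
noncomputable def qpCount (S : Finset (ℤ × ℤ)) (n : ℕ) (a : ℤ × ℤ) : ℕ :=
  Nat.card {f : Fin n → S // qpV S n a f}

theorem qpCount_zero (S : Finset (ℤ × ℤ)) (a : ℤ × ℤ) : qpCount S 0 a = 1 := by
  unfold qpCount
  rw [Nat.card_eq_one_iff_unique]
  refine ⟨inferInstance, ⟨⟨fun k => k.elim0, fun k => k.elim0⟩⟩⟩

theorem qpCount_succ (S : Finset (ℤ × ℤ)) (n : ℕ) (a : ℤ × ℤ) :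
    qpCount S (n+1) a = ∑ s ∈ S, if 0 ≤ a.1 + s.1 ∧ 0 ≤ a.2 + s.2 then qpCount S n (a + s) else 0 := by
  classical
  rw [← Finset.sum_coe_sort S (fun s => if 0 ≤ a.1 + s.1 ∧ 0 ≤ a.2 + s.2 then qpCount S n (a + s) else 0)]
  have e1 : {f : Fin (n+1) → S // qpV S (n+1) a f} ≃
      Σ s : S, {f : Fin n → S // (0 ≤ a.1 + s.1.1 ∧ 0 ≤ a.2 + s.1.2) ∧ qpV S n (a + s.1) f} :=
    { toFun := fun f => ⟨f.1 0, Fin.tail f.1, by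
        rw [← qpV_cons, Fin.cons_self_tail]; exact f.2⟩
      invFun := fun p => ⟨Fin.cons p.1 p.2.1, (qpV_cons _ _ _ _ _).2 p.2.2⟩
      left_inv := fun f => by simp
      right_inv := fun p => rfl }
  unfold qpCount
  rw [Nat.card_congr e1, Nat.card_sigma]
  apply Finset.sum_congr rfl
  intro s _
  split_ifs with h
  · simp [h]
  · simp [h]

theorem qpWalks_eq (S : Finset (ℤ × ℤ)) (n : ℕ) : quarterPlaneWalks S n = qpCount S n 0 := by
  unfold quarterPlaneWalks qpCount
  apply Nat.card_congr
  exact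
    { toFun := fun f => ⟨fun k => ⟨f.1 k, f.2.1 k⟩, fun k => by simpa using f.2.2 k⟩
      invFun := fun f => ⟨fun k => (f.1 k).1, fun k => (f.1 k).2, fun k => by simpa using f.2 k⟩
      left_inv := fun f => by simp
      right_inv := fun f => by simp }

/-- Transfer operator of the model. -/
def qpM (g : ℕ → ℕ → ℂ) (i j : ℕ) : ℂ :=
  (match i with | 0 => 0 | i' + 1 => g i' (j + 1)) + g i (j + 1) +
  (match j with | 0 => 0 | j' + 1 => g (i + 1) j')

theorem qpCount_eq (n : ℕ) : ∀ i j : ℕ,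
    (qpCount ({(-1,1),(0,1),(1,-1)} : Finset (ℤ × ℤ)) n (i, j) : ℂ) = qpM^[n] (fun _ _ => 1) i j := by
  induction n with
  | zero => intro i j; simp [qpCount_zero]
  | succ n ih =>
    intro i j
    rw [qpCount_succ, Function.iterate_succ', Function.comp_apply, qpM.eq_def]
    have hS : ∀ F : ℤ × ℤ → ℕ, ∑ s ∈ ({(-1,1),(0,1),(1,-1)} : Finset (ℤ × ℤ)), F s = F (-1,1) + F (0,1) + F (1,-1) := by
      intro F
      rw [Finset.sum_insert (by decide), Finset.sum_insert (by decide), Finset.sum_singleton]; ring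
    rw [hS]
    push_cast
    congr 1
    · congr 1
      · cases i with
        | zero => simp
        | succ i =>
          simp only
          rw [← ih, if_pos (by constructor <;> push_cast <;> omega)]
          simp
      · rw [← ih, if_pos (by constructor <;> push_cast <;> omega)]
        simp
    · cases j with
      | zero => simp
      | succ j =>
        simp only
        rw [← ih, if_pos (by constructor <;> push_cast <;> omega)]
        simp

theorem qpM_bound (g : ℕ → ℕ → ℂ) (C : ℝ) (hg : ∀ i j, ‖g i j‖ ≤ C) (i j : ℕ) : ‖qpM g i j‖ ≤ 3 * C := by
  have hC : 0 ≤ C := (norm_nonneg _).trans (hg 0 0)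
  unfold qpM
  refine (norm_add₃_le).trans ?_
  have h0 := hg i (j+1)
  cases i with
  | zero =>
    cases j with
    | zero => simp only [norm_zero]; linarith
    | succ j => simp only [norm_zero]; linarith [hg (0+1) j]
  | succ i =>
    cases j with
    | zero => simp only [norm_zero]; linarith [hg i (0+1)]
    | succ j => simp only; linarith [hg (i+1+1) j, hg i (j+1+1)]

theorem qpM_iter_bound (g : ℕ → ℕ → ℂ) (hg : ∀ i j, ‖g i j‖ ≤ 1) (n : ℕ) :
    ∀ i j, ‖qpM^[n] g i j‖ ≤ 3 ^ n := by
  induction n with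
  | zero => simpa using hg
  | succ n ih =>
    intro i j
    rw [Function.iterate_succ', Function.comp_apply, pow_succ, mul_comm]
    exact qpM_bound _ _ ih i j

theorem qpM_comb (g1 g2 g3 : ℕ → ℕ → ℂ) (a b c : ℂ) :
    qpM (fun i j => a * g1 i j + b * g2 i j + c * g3 i j) =
      fun i j => a * qpM g1 i j + b * qpM g2 i j + c * qpM g3 i j := by
  ext i j
  unfold qpM
  cases i <;> cases j <;> simp <;> ring

theorem qpM_smul (g : ℕ → ℕ → ℂ) (a : ℂ) :
    qpM (fun i j => a * g i j) = fun i j => a * qpM g i j := by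
  ext i j
  unfold qpM
  cases i <;> cases j <;> simp <;> ring

theorem qpM_iter_comb (g1 g2 g3 : ℕ → ℕ → ℂ) (a b c : ℂ) (n : ℕ) :
    qpM^[n] (fun i j => a * g1 i j + b * g2 i j + c * g3 i j) =
      fun i j => a * qpM^[n] g1 i j + b * qpM^[n] g2 i j + c * qpM^[n] g3 i j := by
  induction n with
  | zero => rfl
  | succ n ih => simp only [Function.iterate_succ', Function.comp_apply]; rw [ih, qpM_comb]

theorem qpM_iter_smul (g : ℕ → ℕ → ℂ) (a : ℂ) (n : ℕ) :
    qpM^[n] (fun i j => a * g i j) = fun i j => a * qpM^[n] g i j := by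
  induction n with
  | zero => rfl
  | succ n ih => simp only [Function.iterate_succ', Function.comp_apply]; rw [ih, qpM_smul]

/-- Monomial test function. -/
def qpMon (x y : ℂ) (i j : ℕ) : ℂ := x ^ i * y ^ j

theorem qpM_mon (x y : ℂ) : (fun i j => (x * y) * qpM (qpMon x y) i j) =
    fun i j => (y^2 + x*y^2 + x^2) * qpMon x y i j + (-x^2) * qpMon x 0 i j + (-y^2) * qpMon 0 y i j := by
  ext i j
  unfold qpM qpMon
  cases i <;> cases j <;> simp <;> ring

/-- The polynomial `P n x y`. -/
noncomputable def qpP (n : ℕ) (x y : ℂ) : ℂ := qpM^[n] (qpMon x y) 0 0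

theorem qpP_zero (x y : ℂ) : qpP 0 x y = 1 := by simp [qpP, qpMon]

theorem qpP_succ (n : ℕ) (x y : ℂ) : (x * y) * qpP (n+1) x y =
    (y^2 + x*y^2 + x^2) * qpP n x y - x^2 * qpP n x 0 - y^2 * qpP n 0 y := by
  have h := congrArg (fun g => qpM^[n] g 0 0) (qpM_mon x y)
  simp only [qpM_iter_comb, qpM_iter_smul] at h
  unfold qpP
  rw [Function.iterate_succ, Function.comp_apply, h]; ring

theorem qpP_bound (n : ℕ) {x y : ℂ} (hx : ‖x‖ ≤ 1) (hy : ‖y‖ ≤ 1) : ‖qpP n x y‖ ≤ 3 ^ n := by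
  apply qpM_iter_bound
  intro i j
  rw [qpMon, norm_mul, norm_pow, norm_pow]
  exact mul_le_one₀ (pow_le_one₀ (norm_nonneg _) hx) (by positivity) (pow_le_one₀ (norm_nonneg _) hy)

theorem qpP_one (n : ℕ) : ((PowerSeries.coeff n (walkGF ({(-1,1),(0,1),(1,-1)} : Finset (ℤ × ℤ))) : ℚ) : ℂ) = qpP n 1 1 := by
  have h := qpCount_eq n 0 0
  simp only [walkGF, PowerSeries.coeff_mk, qpWalks_eq, qpP]
  rw [show qpMon 1 1 = fun _ _ => 1 by ext; simp [qpMon], ← h]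
  push_cast
  rfl

/-- The complete generating function. -/
noncomputable def qpQ (t x y : ℂ) : ℂ := ∑' n, qpP n x y * t ^ n

theorem qpQ_hasSum {t x y : ℂ} (ht : ‖t‖ < 1/3) (hx : ‖x‖ ≤ 1) (hy : ‖y‖ ≤ 1) :
    HasSum (fun n => qpP n x y * t ^ n) (qpQ t x y) ∧ ‖qpQ t x y‖ ≤ (1 - 3 * ‖t‖)⁻¹ := by
  have h0 : HasSum (fun n : ℕ => (3 * ‖t‖) ^ n) (1 - 3 * ‖t‖)⁻¹ :=
    hasSum_geometric_of_lt_one (by positivity) (by linarith)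
  have hb : ∀ n, ‖qpP n x y * t ^ n‖ ≤ (3 * ‖t‖) ^ n := by
    intro n
    rw [norm_mul, norm_pow, mul_pow]
    gcongr
    exact qpP_bound n hx hy
  exact ⟨(Summable.of_norm_bounded h0.summable hb).hasSum, tsum_of_norm_bounded h0 hb⟩

theorem qpQ_eq {t x y : ℂ} (ht : ‖t‖ < 1/3) (hx : ‖x‖ ≤ 1) (hy : ‖y‖ ≤ 1) :
    x * y * (qpQ t x y - 1) = t * ((y^2 + x*y^2 + x^2) * qpQ t x y - x^2 * qpQ t x 0 - y^2 * qpQ t 0 y) := by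
  have z0 : ‖(0:ℂ)‖ ≤ 1 := by simp
  have h1 := (qpQ_hasSum ht hx hy).1
  have h2 := (qpQ_hasSum ht hx z0).1
  have h3 := (qpQ_hasSum ht z0 hy).1
  have h4 := (((h1.mul_left (y^2 + x*y^2 + x^2)).sub (h2.mul_left (x^2))).sub (h3.mul_left (y^2))).mul_left t
  have h5 := (((hasSum_nat_add_iff' 1).2 h1).mul_left (x * y))
  simp only [Finset.range_one, Finset.sum_singleton, qpP_zero, pow_zero, mul_one] at h5
  refine h5.unique ?_
  convert h4 using 2 with n
  have := qpP_succ n x y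
  linear_combination t ^ (n+1) * this

theorem qp_coeff_bound (n : ℕ) : ‖((PowerSeries.coeff n (walkGF ({(-1,1),(0,1),(1,-1)} : Finset (ℤ × ℤ))) : ℚ) : ℂ)‖ ≤ 3 ^ n := by
  rw [qpP_one]; exact qpP_bound n (by simp) (by simp)

theorem qp_tail (F : ℂ → ℂ → ℂ) (b Q : ℂ → ℂ) (z0 : ℂ) (hb : AnalyticAt ℂ b z0) (hQ : AnalyticAt ℂ Q z0)
    (hQ1 : ‖Q z0‖ < 1) (hF : AnalyticAt ℂ (Function.uncurry F) (0, Q z0)) (hF0 : ∀ w, F 0 w = 0) :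
    ∃ N0, ∀ N ≥ N0, AnalyticAt ℂ (fun z => ∑' n, F (b z * Q z ^ (n + N)) (Q z)) z0 ∧
      ∀ᶠ z in 𝓝 z0, Summable (fun n => F (b z * Q z ^ n) (Q z)) := by
  obtain ⟨L, W, hW, hLip⟩ := (hF.contDiffAt (n := 1)).exists_lipschitzOnWith
  have hW' := Filter.inter_mem hW (show {p | AnalyticAt ℂ (Function.uncurry F) p} ∈ 𝓝 _ from hF.eventually_analyticAt)
  obtain ⟨ε, hε, hball⟩ := Metric.mem_nhds_iff.1 hW'
  obtain ⟨ρ, hρ1, hρ2⟩ := exists_between hQ1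
  have hρ0 : 0 ≤ ρ := (norm_nonneg _).trans hρ1.le
  set B : ℝ := ‖b z0‖ + 1 with hB
  have hBpos : 0 < B := by positivity
  have hev : ∀ᶠ z in 𝓝 z0, ‖Q z‖ < ρ ∧ Q z ∈ Metric.ball (Q z0) ε ∧ ‖b z‖ < B ∧ AnalyticAt ℂ b z ∧ AnalyticAt ℂ Q z := by
    refine (hQ.continuousAt.norm.eventually (gt_mem_nhds hρ1)).and ((hQ.continuousAt.eventually (Metric.ball_mem_nhds _ hε)).and
      ((hb.continuousAt.norm.eventually (gt_mem_nhds (by linarith))).and (hb.eventually_analyticAt.and hQ.eventually_analyticAt)))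
  obtain ⟨V, hV, hVo, hVz⟩ := eventually_nhds_iff.1 hev
  obtain ⟨N0, hN0⟩ := exists_pow_lt_of_lt_one (div_pos hε hBpos) hρ2
  rw [lt_div_iff₀ hBpos] at hN0
  refine ⟨N0, fun N hN => ?_⟩
  have hNN : ρ ^ N * B < ε := lt_of_le_of_lt (mul_le_mul_of_nonneg_right (pow_le_pow_of_le_one hρ0 hρ2.le hN) hBpos.le) hN0
  have ha : ∀ z ∈ V, ∀ n, ‖b z * Q z ^ (n + N)‖ ≤ ρ ^ n * (ρ ^ N * B) := by
    intro z hz n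
    obtain ⟨h1, h2, h3, h4, h5⟩ := hV z hz
    rw [norm_mul, norm_pow]
    calc ‖b z‖ * ‖Q z‖ ^ (n + N) ≤ B * ρ ^ (n + N) := by gcongr
      _ = _ := by rw [pow_add]; ring
  have ha' : ∀ z ∈ V, ∀ n, ‖b z * Q z ^ (n + N)‖ < ε := by
    intro z hz n
    refine (ha z hz n).trans_lt (lt_of_le_of_lt ?_ hNN)
    have : ρ ^ n ≤ 1 := pow_le_one₀ hρ0 hρ2.le
    have h2 : 0 ≤ ρ ^ N * B := by positivity
    nlinarith
  have hmem : ∀ z ∈ V, ∀ a : ℂ, ‖a‖ < ε → (a, Q z) ∈ Metric.ball ((0 : ℂ), Q z0) ε := by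
    intro z hz a ha
    rw [← ball_prod_same]
    exact ⟨by simpa using ha, (hV z hz).2.1⟩
  have hbd : ∀ (n : ℕ), ∀ z ∈ V, ‖F (b z * Q z ^ (n + N)) (Q z)‖ ≤ L * (ρ ^ N * B) * ρ ^ n := by
    intro n z hz
    have h1 := (hball (hmem z hz _ (ha' z hz n))).1
    have h2 := (hball (hmem z hz 0 (by simpa using hε))).1
    have h3 := hLip.dist_le_mul _ h1 _ h2
    simp only [Function.uncurry, dist_eq_norm, hF0, sub_zero, Prod.mk_sub_mk, sub_self, Prod.norm_mk, norm_zero] at h3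
    rw [max_eq_left (norm_nonneg _)] at h3
    refine h3.trans ?_
    calc (L:ℝ) * ‖b z * Q z ^ (n + N)‖ ≤ L * (ρ ^ n * (ρ ^ N * B)) := by
          gcongr; exact ha z hz n
      _ = _ := by ring
  have hsum : Summable fun n : ℕ => L * (ρ ^ N * B) * ρ ^ n := (summable_geometric_of_lt_one hρ0 hρ2).mul_left _
  constructor
  · refine DifferentiableOn.analyticAt (s := V) ?_ (hVo.mem_nhds hVz)
    refine Complex.differentiableOn_tsum_of_summable_norm hsum ?_ hVo hbd
    intro n z hz
    have h1 := (hball (hmem z hz _ (ha' z hz n))).2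
    obtain ⟨-, -, -, h4, h5⟩ := hV z hz
    have : AnalyticAt ℂ (fun z => Function.uncurry F (b z * Q z ^ (n + N), Q z)) z :=
      AnalyticAt.fun_comp h1 ((h4.mul (h5.pow _)).prod h5)
    exact this.differentiableAt.differentiableWithinAt
  · filter_upwards [hVo.mem_nhds hVz] with z hz
    rw [← summable_nat_add_iff N]
    exact Summable.of_norm_bounded hsum (fun n => hbd n z hz)

/-- The tsum splits near the point. -/
theorem qp_split (F : ℂ → ℂ → ℂ) (b Q : ℂ → ℂ) (z0 : ℂ) (hb : AnalyticAt ℂ b z0) (hQ : AnalyticAt ℂ Q z0)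
    (hQ1 : ‖Q z0‖ < 1) (hF : AnalyticAt ℂ (Function.uncurry F) (0, Q z0)) (hF0 : ∀ w, F 0 w = 0) :
    ∃ N0, ∀ N ≥ N0, ∃ E : ℂ → ℂ, AnalyticAt ℂ E z0 ∧
      (fun z => ∑' n, F (b z * Q z ^ n) (Q z)) =ᶠ[𝓝 z0]
        fun z => ∑ n ∈ Finset.range N, F (b z * Q z ^ n) (Q z) + E z := by
  obtain ⟨N0, h⟩ := qp_tail F b Q z0 hb hQ hQ1 hF hF0
  refine ⟨N0, fun N hN => ⟨_, (h N hN).1, ?_⟩⟩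
  filter_upwards [(h N hN).2] with z hz
  exact (hz.sum_add_tsum_nat_add N).symm

/-- Kernel of the first sum. -/
noncomputable def qpTau (a Q : ℂ) : ℂ := a^2 * (1 - a^2*Q) / ((1-a)^3 * (1-a*Q)^3)
/-- Kernel of the second sum. -/
noncomputable def qpSig (e Q : ℂ) : ℂ := e^2 * (1 + Q*e) / ((1-Q*e)^3 * (1-e) * (1-Q^2*e))

theorem qpTau_an' {E : Type*} [NormedAddCommGroup E] [NormedSpace ℂ E] (x y : E → ℂ) (p : E)
    (hx : AnalyticAt ℂ x p) (hy : AnalyticAt ℂ y p) (h1 : x p ≠ 1) (h2 : x p * y p ≠ 1) :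
    AnalyticAt ℂ (fun p => qpTau (x p) (y p)) p := by
  unfold qpTau
  refine AnalyticAt.div (by fun_prop) (by fun_prop) ?_
  simp [sub_eq_zero, h1.symm, h2.symm]

theorem qpTau_an (a Q : ℂ) (h1 : a ≠ 1) (h2 : a * Q ≠ 1) : AnalyticAt ℂ (Function.uncurry qpTau) (a, Q) :=
  qpTau_an' (fun p : ℂ × ℂ => p.1) (fun p => p.2) (a, Q) analyticAt_fst analyticAt_snd h1 h2

theorem qpSig_an' {E : Type*} [NormedAddCommGroup E] [NormedSpace ℂ E] (x y : E → ℂ) (p : E)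
    (hx : AnalyticAt ℂ x p) (hy : AnalyticAt ℂ y p) (h0 : y p * x p ≠ 1) (h1 : x p ≠ 1) (h2 : y p ^ 2 * x p ≠ 1) :
    AnalyticAt ℂ (fun p => qpSig (x p) (y p)) p := by
  unfold qpSig
  refine AnalyticAt.div (by fun_prop) (by fun_prop) ?_
  simp [sub_eq_zero, h1.symm, h2.symm, h0.symm]

theorem qpSig_an (a Q : ℂ) (h0 : Q * a ≠ 1) (h1 : a ≠ 1) (h2 : Q ^ 2 * a ≠ 1) : AnalyticAt ℂ (Function.uncurry qpSig) (a, Q) :=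
  qpSig_an' (fun p : ℂ × ℂ => p.1) (fun p => p.2) (a, Q) analyticAt_fst analyticAt_snd h0 h1 h2

theorem qpTau_mero {b Q : ℂ → ℂ} {z : ℂ} (hb : MeromorphicAt b z) (hQ : MeromorphicAt Q z) :
    MeromorphicAt (fun z => qpTau (b z) (Q z)) z := by
  unfold qpTau; fun_prop

theorem qpSig_mero {b Q : ℂ → ℂ} {z : ℂ} (hb : MeromorphicAt b z) (hQ : MeromorphicAt Q z) :
    MeromorphicAt (fun z => qpSig (b z) (Q z)) z := by
  unfold qpSig; fun_prop

theorem qp_sum_mero (F : ℂ → ℂ → ℂ) (b Q : ℂ → ℂ) (z0 : ℂ) (hb : AnalyticAt ℂ b z0) (hQ : AnalyticAt ℂ Q z0)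
    (hQ1 : ‖Q z0‖ < 1) (hF : AnalyticAt ℂ (Function.uncurry F) (0, Q z0)) (hF0 : ∀ w, F 0 w = 0)
    (hFm : ∀ n : ℕ, MeromorphicAt (fun z => F (b z * Q z ^ n) (Q z)) z0) :
    MeromorphicAt (fun z => ∑' n, F (b z * Q z ^ n) (Q z)) z0 := by
  obtain ⟨N0, h⟩ := qp_split F b Q z0 hb hQ hQ1 hF hF0
  obtain ⟨E, hE, hEq⟩ := h N0 le_rfl
  refine MeromorphicAt.congr ?_ (hEq.symm.filter_mono nhdsWithin_le_nhds)
  exact (MeromorphicAt.fun_sum fun i _ => hFm i).add hE.meromorphicAt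

theorem qp_sum_an (F : ℂ → ℂ → ℂ) (b Q : ℂ → ℂ) (z0 : ℂ) (hb : AnalyticAt ℂ b z0) (hQ : AnalyticAt ℂ Q z0)
    (hQ1 : ‖Q z0‖ < 1) (hF : AnalyticAt ℂ (Function.uncurry F) (0, Q z0)) (hF0 : ∀ w, F 0 w = 0)
    (hFm : ∀ n : ℕ, AnalyticAt ℂ (fun z => F (b z * Q z ^ n) (Q z)) z0) :
    AnalyticAt ℂ (fun z => ∑' n, F (b z * Q z ^ n) (Q z)) z0 := by
  obtain ⟨N0, h⟩ := qp_split F b Q z0 hb hQ hQ1 hF hF0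
  obtain ⟨E, hE, hEq⟩ := h N0 le_rfl
  refine AnalyticAt.congr ?_ hEq.symm
  exact (Finset.analyticAt_fun_sum _ fun i _ => hFm i).add hE

/-- Pole of the tau sum: `b Q^m = 1` at `z0`. -/
theorem qpTau_pole (b Q : ℂ → ℂ) (z0 : ℂ) (hb : AnalyticAt ℂ b z0) (hQ : AnalyticAt ℂ Q z0)
    (hQ1 : ‖Q z0‖ < 1) (hQ0 : Q z0 ≠ 0) (m : ℕ) (hm : b z0 * Q z0 ^ (m+1) = 1) :
    ∃ E : ℂ → ℂ, AnalyticAt ℂ E z0 ∧ E z0 ≠ 0 ∧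
      ∀ᶠ z in 𝓝[≠] z0, (b z * Q z ^ (m+1) ≠ 1 → 
        ∑' n, qpTau (b z * Q z ^ n) (Q z) = E z / (1 - b z * Q z ^ (m+1)) ^ 3) := by
  have hQne : Q z0 ≠ 1 := by rintro h; rw [h] at hQ1; simp at hQ1
  have hpow : ∀ k : ℕ, 0 < k → Q z0 ^ k ≠ 1 := by
    intro k hk h
    have := congrArg norm h
    rw [norm_pow, norm_one] at this
    exact (pow_lt_one₀ (norm_nonneg _) hQ1 hk.ne').ne this
  have hterm : ∀ n : ℕ, n ≠ m + 1 → b z0 * Q z0 ^ n ≠ 1 := by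
    intro n hn h
    rcases lt_or_gt_of_ne hn with h1 | h1
    · obtain ⟨k, hk⟩ := Nat.exists_eq_add_of_lt h1
      apply hpow (k+1) (by omega)
      have : b z0 * Q z0 ^ (m+1) = (b z0 * Q z0 ^ n) * Q z0 ^ (k+1) := by
        rw [hk]; ring
      rw [hm, h, one_mul] at this
      exact this.symm
    · obtain ⟨k, rfl⟩ := Nat.exists_eq_add_of_lt h1
      apply hpow (k+1) (by omega)
      have : b z0 * Q z0 ^ (m+1+k+1) = (b z0 * Q z0 ^ (m+1)) * Q z0 ^ (k+1) := by ring
      rw [hm, h, one_mul] at this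
      exact this.symm
  obtain ⟨N0, h⟩ := qp_split qpTau b Q z0 hb hQ hQ1 (qpTau_an _ _ (by simp) (by simp)) (by simp [qpTau])
  obtain ⟨E, hE, hEq⟩ := h (N0 + (m + 2)) (by omega)
  set s := ((Finset.range (N0 + (m+2))).erase m).erase (m+1) with hs
  have hEs : AnalyticAt ℂ (fun z => ∑ n ∈ s, qpTau (b z * Q z ^ n) (Q z)) z0 := by
    apply Finset.analyticAt_fun_sum
    intro n hn
    simp only [hs, Finset.mem_erase, Finset.mem_range] at hn
    have h1 : AnalyticAt ℂ (Function.uncurry qpTau) (b z0 * Q z0 ^ n, Q z0) := by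
      refine qpTau_an _ _ (hterm n hn.1) ?_
      rw [mul_assoc, ← pow_succ]
      exact hterm (n+1) (by omega)
    exact AnalyticAt.fun_comp (f := fun z => (b z * Q z ^ n, Q z)) h1 ((hb.mul (hQ.pow _)).prod hQ)
  have hsum : ∀ z, ∑ n ∈ Finset.range (N0 + (m+2)), qpTau (b z * Q z ^ n) (Q z) =
      qpTau (b z * Q z ^ m) (Q z) + (qpTau (b z * Q z ^ (m+1)) (Q z) + ∑ n ∈ s, qpTau (b z * Q z ^ n) (Q z)) := by
    intro z
    rw [hs, Finset.add_sum_erase _ (fun n => qpTau (b z * Q z ^ n) (Q z)) (by simp; omega),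
      Finset.add_sum_erase _ (fun n => qpTau (b z * Q z ^ n) (Q z)) (by simp; omega)]
  set A : ℂ → ℂ := fun z => b z * Q z ^ m
  have hA : AnalyticAt ℂ A z0 := hb.mul (hQ.pow _)
  have hAQ : A z0 * Q z0 = 1 := by rw [← hm]; simp only [A]; ring
  have hA1 : A z0 ≠ 1 := hterm m (by omega)
  refine ⟨fun z => (A z^2 * (1 - A z^2*Q z) / ((1-A z)^3)) +
    ((A z * Q z)^2 * (1 - (A z * Q z)^2*Q z) / (1-A z * Q z * Q z)^3) +
    (1 - A z * Q z)^3 * (∑ n ∈ s, qpTau (b z * Q z ^ n) (Q z) + E z), ?_, ?_, ?_⟩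
  · refine AnalyticAt.add (AnalyticAt.add (AnalyticAt.div (by fun_prop) (by fun_prop) ?_) (AnalyticAt.div (by fun_prop) (by fun_prop) ?_)) ?_
    · simpa [sub_eq_zero] using hA1.symm
    · simpa [sub_eq_zero, hAQ] using hQne.symm
    · exact (AnalyticAt.pow (by fun_prop) _).mul (hEs.add hE)
  · have hAv : A z0 = (Q z0)⁻¹ := eq_inv_of_mul_eq_one_left hAQ
    simp only [hAQ]
    simp only [hAv]
    have h1 : 1 - Q z0 ≠ 0 := sub_ne_zero.2 hQne.symm
    have h3 : Q z0 - 1 ≠ 0 := sub_ne_zero.2 hQne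
    have h2 : 1 - (Q z0)⁻¹ = -(1 - Q z0) / Q z0 := by field_simp; ring
    have : (Q z0)⁻¹ ^ 2 * (1 - (Q z0)⁻¹ ^ 2 * Q z0) / (1 - (Q z0)⁻¹) ^ 3 +
      1 ^ 2 * (1 - 1 ^ 2 * Q z0) / (1 - 1 * Q z0) ^ 3 = 2 / (1 - Q z0)^2 := by
      rw [h2]; field_simp; ring
    rw [this]
    simp only [sub_self]
    simpa using h1
  · have c1 : ∀ᶠ z in 𝓝 z0, A z ≠ 1 := hA.continuousAt.eventually_ne hA1
    have c2 : ∀ᶠ z in 𝓝 z0, A z * Q z * Q z ≠ 1 :=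
      ((hA.mul hQ).mul hQ).continuousAt.eventually_ne (by simpa [hAQ] using hQne)
    filter_upwards [hEq.filter_mono nhdsWithin_le_nhds, c1.filter_mono nhdsWithin_le_nhds, c2.filter_mono nhdsWithin_le_nhds] with z e1 e2 e3 e4
    have e5 : b z * Q z ^ (m+1) = A z * Q z := by simp only [A]; ring
    rw [e1, hsum]
    rw [e5] at e4 ⊢
    have f2 : 1 - A z ≠ 0 := sub_ne_zero.2 e2.symm
    have f3 : 1 - A z * Q z * Q z ≠ 0 := sub_ne_zero.2 e3.symm
    have f4 : 1 - A z * Q z ≠ 0 := sub_ne_zero.2 e4.symm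
    change qpTau (A z) (Q z) + _ + _ = _
    rw [eq_div_iff (pow_ne_zero _ f4)]
    have g1 : qpTau (A z) (Q z) * (1 - A z * Q z)^3 = (A z^2 * (1 - A z^2*Q z) / ((1-A z)^3)) := by
      unfold qpTau; field_simp
    have g2 : qpTau (A z * Q z) (Q z) * (1 - A z * Q z)^3 = ((A z * Q z)^2 * (1 - (A z * Q z)^2*Q z) / (1-A z * Q z * Q z)^3) := by
      unfold qpTau; field_simp
    rw [← g1, ← g2]; ring
theorem qp_alg1 (q a : ℂ) (h0 : q ≠ 0) (hQ : 1 + q^2 ≠ 0) (h1 : 1 - a ≠ 0) (h2 : 1 - a * q^2 ≠ 0) (c t x y : ℂ)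
    (hc : c = -(1-q^2)^2/q^2) (ht : t = q / (1 + q^2)) (hx : x = c * a / (1-a)^2)
    (hy : y = c * q * a / ((1 - a * q^2) * (1 - a))) :
    x * y = t * (y^2 + x*y^2 + x^2) := by
  have h2' : 1 - q^2 * a ≠ 0 := by rwa [mul_comm] at h2
  subst hx hy hc ht
  field_simp
  ring

theorem qp_alg2 (q a : ℂ) (h0 : q ≠ 0) (hQ : 1 + q^2 ≠ 0) (h1 : 1 - a ≠ 0) (h2 : 1 - a * q^2 ≠ 0) (c t x y : ℂ)
    (hc : c = -(1-q^2)^2/q^2) (ht : t = q / (1 + q^2)) (hx : x = c * (a * q^2) / (1-a * q^2)^2)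
    (hy : y = c * q * a / ((1 - a * q^2) * (1 - a))) :
    x * y = t * (y^2 + x*y^2 + x^2) := by
  have h2' : 1 - q^2 * a ≠ 0 := by rwa [mul_comm] at h2
  subst hx hy hc ht
  field_simp
  ring

theorem qp_alg3 (q b : ℂ) (h0 : q ≠ 0) (hQ : 1 + q^2 ≠ 0) (h1 : 1 - q * b ≠ 0) (h2 : 1 - b / q ≠ 0) (c t x y : ℂ)
    (hc : c = -(1-q^2)^2/q^2) (ht : t = q / (1 + q^2)) (hx : x = c * q * b / (1-q * b)^2)
    (hy : y = c * b / ((1 - q * b) * (1 - b / q))) :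
    x * y = t * (y^2 + x*y^2 + x^2) := by
  have h2' : q - b ≠ 0 := by
    intro h; apply h2; rw [← sub_eq_zero.1 h, div_self h0, sub_self]
  subst hx hy hc ht
  field_simp
  ring

theorem qp_alg4 (q b : ℂ) (h0 : q ≠ 0) (hQ : 1 + q^2 ≠ 0) (h1 : 1 - q * b ≠ 0) (h2 : 1 - q^3 * b ≠ 0) (c t x y : ℂ)
    (hc : c = -(1-q^2)^2/q^2) (ht : t = q / (1 + q^2)) (hx : x = c * q * b / (1-q * b)^2)
    (hy : y = c * (b * q^2) / ((1 - q^3 * b) * (1 - q * b))) :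
    x * y = t * (y^2 + x*y^2 + x^2) := by
  subst hx hy hc ht
  field_simp
  ring

theorem qp_alg5 (q b c : ℂ) (h0 : q ≠ 0) (h1 : 1 - q * b ≠ 0) (h2 : 1 - b / q ≠ 0) (h3 : 1 - q^3 * b ≠ 0) :
    (c * b / ((1 - q * b) * (1 - b / q)) - c * (b * q^2) / ((1 - q^3 * b) * (1 - q * b))) * (c * q * b / (1-q * b)^2)
     = c^2 * q * (1 - q^2) * (b^2 * (1 + q*b) / ((1-q*b)^3 * (1-b/q) * (1-q^3*b))) := by
  have h2' : q - b ≠ 0 := by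
    intro h; apply h2; rw [← sub_eq_zero.1 h, div_self h0, sub_self]
  have h1' : 1 - b * q ≠ 0 := by rwa [mul_comm] at h1
  have h3' : 1 - b * q^3 ≠ 0 := by rwa [mul_comm] at h3
  field_simp
  ring

theorem qp_tele (ρ K : ℝ) (hρ0 : 0 ≤ ρ) (hρ : ρ < 1) (x y : ℕ → ℂ) (R S : ℂ → ℂ)
    (h1 : ∀ n, R (x n) + S (y n) = x n * y n) (h2 : ∀ n, R (x (n+1)) + S (y n) = x (n+1) * y n)
    (hb : ∀ n, ‖R (x n)‖ ≤ K * ρ ^ n) :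
    Summable (fun n => (x n - x (n+1)) * y n) ∧ R (x 0) = ∑' n, (x n - x (n+1)) * y n := by
  have hs : Summable (fun n => R (x n)) :=
    Summable.of_norm_bounded ((summable_geometric_of_lt_one hρ0 hρ).mul_left K) hb
  have hs' : Summable (fun n => R (x (n+1))) := (summable_nat_add_iff 1).2 hs
  have e : (fun n => (x n - x (n+1)) * y n) = fun n => R (x n) - R (x (n+1)) := by
    funext n
    linear_combination (-1 : ℂ) * h1 n + h2 n
  rw [e]
  refine ⟨hs.sub hs', ?_⟩
  rw [hs.tsum_sub hs', hs.tsum_eq_zero_add]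
  ring

theorem qp_curve (t x y : ℂ) (ht : ‖t‖ < 1/3) (hx : ‖x‖ ≤ 1) (hy : ‖y‖ ≤ 1)
    (h : x * y = t * (y^2 + x*y^2 + x^2)) :
    t * x^2 * qpQ t x 0 + t * y^2 * qpQ t 0 y = x * y := by
  have := qpQ_eq ht hx hy
  linear_combination this - qpQ t x y * h

theorem qp_one_sub (z : ℂ) (r : ℝ) (h : ‖z‖ ≤ r) : 1 - r ≤ ‖1 - z‖ ∧ ‖1 - z‖ ≤ 1 + r := by
  constructor
  · have := norm_sub_norm_le (1:ℂ) z
    rw [norm_one] at this; linarith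
  · have := norm_sub_le (1:ℂ) z
    rw [norm_one] at this; linarith

/-- Exceptional first term of the second sum. -/
noncomputable def qpSig0 (b q : ℂ) : ℂ := b^2 * (1 + q*b) / ((1-q*b)^3 * (1-b/q) * (1-q^3*b))

theorem qp_quot (A B C D : ℂ) (hA : ‖A‖ ≤ 11/10) (hB : ‖B‖ ≤ 101/100) (hC : 9/10 ≤ ‖C‖) (hD : 99/100 ≤ ‖D‖) :
    ‖A * B / (C * D)‖ ≤ 2 := by
  rw [norm_div, norm_mul, norm_mul, div_le_iff₀ (by positivity)]
  have : ‖A‖ * ‖B‖ ≤ (11/10) * (101/100) := by gcongr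
  have : (9/10) * (99/100) ≤ ‖C‖ * ‖D‖ := by gcongr
  linarith

theorem qp_ne (z : ℂ) (r : ℝ) (h : ‖z‖ ≤ r) (hr : r < 1) : 1 - z ≠ 0 := by
  intro h0
  have := (qp_one_sub z r h).1
  rw [h0, norm_zero] at this; linarith

theorem qp_Rbound (t x : ℂ) (ht : ‖t‖ < 1/3) (hx1 : ‖x‖ ≤ 1) (ρ : ℝ) (hx : ‖x‖ ≤ 2 * ρ) :
    ‖t * x^2 * qpQ t x 0‖ ≤ 2 * (1 - 3 * ‖t‖)⁻¹ * ρ ∧ ‖t * x^2 * qpQ t 0 x‖ ≤ 2 * (1 - 3 * ‖t‖)⁻¹ * ρ := by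
  have hM : 0 < (1 - 3 * ‖t‖)⁻¹ := by apply inv_pos.2; linarith
  have hg : ∀ w : ℂ, ‖w‖ ≤ (1 - 3 * ‖t‖)⁻¹ → ‖t * x^2 * w‖ ≤ 2 * (1 - 3 * ‖t‖)⁻¹ * ρ := by
    intro w hw
    rw [norm_mul, norm_mul, norm_pow]
    have h1 : ‖t‖ * ‖x‖^2 ≤ 1 * (2 * ρ) := by
      apply mul_le_mul (by linarith) _ (by positivity) zero_le_one
      nlinarith [norm_nonneg x]
    calc _ ≤ (1 * (2 * ρ)) * (1 - 3 * ‖t‖)⁻¹ := mul_le_mul h1 hw (norm_nonneg _) (le_trans (by positivity) h1)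
      _ = _ := by ring
  exact ⟨hg _ (qpQ_hasSum ht hx1 (by simp)).2, hg _ (qpQ_hasSum ht (by simp) hx1).2⟩

theorem qp_Rchain (q t c α : ℂ) (hq0 : q ≠ 0) (hq : ‖q‖ ≤ 1/100) (hα : ‖α‖ ≤ 1/100)
    (ht : t = q / (1 + q^2)) (ht3 : ‖t‖ < 1/3) (hc : c = -(1-q^2)^2/q^2) (hcα : c * α = (1-α)^2) :
    t * qpQ t 1 0 = c^2 * q * (1 - q^2) * (qpTau α (q^2) + ∑' n, qpTau (α * q^2 * (q^2)^n) (q^2)) := by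
  have hQ : ‖q^2‖ ≤ 1/10000 := by
    rw [norm_pow]; nlinarith [norm_nonneg q]
  set Q := q^2 with hQd
  have hQ0 : Q ≠ 0 := pow_ne_zero _ hq0
  have hQn : ∀ n : ℕ, ‖Q^n‖ ≤ 1 := fun n => by
    rw [norm_pow]; exact pow_le_one₀ (norm_nonneg _) (by linarith)
  have ha : ∀ n : ℕ, ‖α * Q^n‖ ≤ 1/100 := fun n => by
    rw [norm_mul]; nlinarith [hQn n, norm_nonneg α, norm_nonneg (Q^n)]
  have ha1 : ∀ n : ℕ, 1 - α * Q^n ≠ 0 := fun n => qp_ne _ _ (ha n) (by norm_num)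
  have ha2 : ∀ n : ℕ, 1 - α * Q^n * Q ≠ 0 := fun n => by
    have := ha1 (n+1); rwa [pow_succ, ← mul_assoc] at this
  have h1α : 1 - α ≠ 0 := by simpa using ha1 0
  have hQ1 : 1 + Q ≠ 0 := by
    have := qp_ne (-Q) _ (by simpa using hQ) (by norm_num); simpa using this
  have hα0 : α ≠ 0 := by
    rintro rfl; simp at hcα
  set x : ℕ → ℂ := fun n => c * (α * Q^n) / (1 - α * Q^n)^2 with hx
  set y : ℕ → ℂ := fun n => c * q * (α * Q^n) / ((1 - α * Q^n * Q) * (1 - α * Q^n)) with hy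
  have hx0 : x 0 = 1 := by
    simp only [hx, pow_zero, mul_one, hcα]; exact div_self (pow_ne_zero _ h1α)
  have hxb : ∀ n, ‖x n‖ ≤ 2 * ‖Q‖^n := by
    intro n
    have : x n = ((1-α) * (1-α) / ((1 - α * Q^n) * (1 - α * Q^n))) * Q^n := by
      simp only [hx]; rw [← mul_assoc, hcα]; ring
    rw [this, norm_mul, norm_pow]
    gcongr
    have l1 := (qp_one_sub _ _ hα).2
    have l2 := (qp_one_sub _ _ (ha n)).1
    apply qp_quot <;> linarith
  have hyb : ∀ n, ‖y n‖ ≤ 1 := by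
    intro n
    have : y n = ((1-α) * (1-α) / ((1 - α * Q^(n+1)) * (1 - α * Q^n))) * (q * Q^n) := by
      simp only [hy]
      have : c * q * (α * Q^n) = (1-α)^2 * q * Q^n := by rw [← hcα]; ring
      rw [this]; ring
    rw [this, norm_mul, norm_mul]
    have l1 := (qp_one_sub _ _ hα).2
    have l2 := (qp_one_sub _ _ (ha n)).1
    have l3 := (qp_one_sub _ _ (ha (n+1))).1
    have l4 : ‖(1-α) * (1-α) / ((1 - α * Q^(n+1)) * (1 - α * Q^n))‖ ≤ 2 := by
      apply qp_quot <;> linarith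
    have l5 : ‖q‖ * ‖Q^n‖ ≤ 1/100 * 1 := by gcongr; exact hQn n
    nlinarith [norm_nonneg ((1-α) * (1-α) / ((1 - α * Q^(n+1)) * (1 - α * Q^n))), norm_nonneg (Q^n), norm_nonneg q]
  have hx1 : ∀ n, ‖x n‖ ≤ 1 := by
    intro n
    rcases n with _ | n
    · simp [hx0]
    · refine (hxb _).trans ?_
      rw [pow_succ]
      have := hQn n
      rw [norm_pow] at this
      have h0 : 0 ≤ ‖Q‖^n := by positivity
      nlinarith [norm_nonneg Q]
  have key := qp_tele ‖Q‖ (2 * (1 - 3 * ‖t‖)⁻¹) (norm_nonneg _) (by linarith) x y (fun x => t * x^2 * qpQ t x 0)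
    (fun y => t * y^2 * qpQ t 0 y) ?_ ?_ ?_
  · obtain ⟨k1, k2⟩ := key
    have hterm : ∀ n, (x n - x (n+1)) * y n = c^2 * q * (1 - Q) * qpTau (α * Q^n) Q := by
      intro n
      have e1 := ha1 n
      have e2 := ha2 n
      simp only [hx, hy, qpTau, pow_succ, ← mul_assoc] at *
      field_simp
      ring
    simp only [hx0, one_pow, mul_one] at k2
    rw [k2]
    simp only [hterm] at k1 ⊢
    rw [tsum_mul_left]
    have hc0 : c ≠ 0 := by
      rintro rfl; rw [zero_mul] at hcα; exact pow_ne_zero 2 h1α hcα.symm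
    have h1Q : 1 - Q ≠ 0 := qp_ne _ _ hQ (by norm_num)
    rw [summable_mul_left_iff (by simp [hc0, hq0, h1Q])] at k1
    rw [k1.tsum_eq_zero_add]
    simp only [pow_zero, mul_one, pow_succ]
    congr 4
    funext n
    congr 1; ring
  · intro n
    refine qp_curve t _ _ ht3 (hx1 n) (hyb n) ?_
    exact qp_alg1 q (α * Q^n) hq0 hQ1 (ha1 n) (ha2 n) c t _ _ hc ht rfl rfl
  · intro n
    refine qp_curve t _ _ ht3 (hx1 (n+1)) (hyb n) ?_
    refine qp_alg2 q (α * Q^n) hq0 hQ1 (ha1 n) (ha2 n) c t _ _ hc ht ?_ rfl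
    simp only [hx]; rw [pow_succ, ← mul_assoc α]
  · intro n
    exact (qp_Rbound t (x n) ht3 (hx1 n) _ (hxb n)).1

theorem qp_Schain (q t c β : ℂ) (hq0 : q ≠ 0) (hq : ‖q‖ ≤ 1/100) (hβ : ‖β‖ ≤ ‖q‖/10)
    (ht : t = q / (1 + q^2)) (ht3 : ‖t‖ < 1/3) (hc : c = -(1-q^2)^2/q^2) (hcβ : c * β = (1-q*β)*(1-β/q)) :
    t * qpQ t 0 1 = c^2 * q * (1 - q^2) * (qpSig0 β q + q^2 * ∑' n, qpSig (β * q * (q^2)^n) (q^2)) := by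
  have hQ : ‖q^2‖ ≤ 1/10000 := by
    rw [norm_pow]; nlinarith [norm_nonneg q]
  set Q := q^2 with hQd
  have hqpos : 0 < ‖q‖ := norm_pos_iff.2 hq0
  have hQ0 : Q ≠ 0 := pow_ne_zero _ hq0
  have hQn : ∀ n : ℕ, ‖Q^n‖ ≤ 1 := fun n => by
    rw [norm_pow]; exact pow_le_one₀ (norm_nonneg _) (by linarith)
  have hb0 : ∀ n : ℕ, ‖β * Q^n‖ ≤ ‖q‖/10 := fun n => by
    rw [norm_mul]; nlinarith [hQn n, norm_nonneg β, norm_nonneg (Q^n)]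
  have hbq : ∀ n : ℕ, ‖β * Q^n / q‖ ≤ 1/10 := fun n => by
    rw [norm_div, div_le_iff₀ hqpos]; linarith [hb0 n]
  have hqb : ∀ n : ℕ, ‖q * (β * Q^n)‖ ≤ 1/100 := fun n => by
    rw [norm_mul]; nlinarith [hb0 n, norm_nonneg (β * Q^n)]
  have hqb3 : ∀ n : ℕ, ‖q^3 * (β * Q^n)‖ ≤ 1/100 := fun n => by
    have : q^3 * (β * Q^n) = q * (β * Q^(n+1)) := by rw [pow_succ Q, hQd]; ring
    rw [this]; exact hqb (n+1)
  have h1 : ∀ n : ℕ, 1 - q * (β * Q^n) ≠ 0 := fun n => qp_ne _ _ (hqb n) (by norm_num)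
  have h2 : ∀ n : ℕ, 1 - β * Q^n / q ≠ 0 := fun n => qp_ne _ _ (hbq n) (by norm_num)
  have h3 : ∀ n : ℕ, 1 - q^3 * (β * Q^n) ≠ 0 := fun n => qp_ne _ _ (hqb3 n) (by norm_num)
  have h10 : 1 - q * β ≠ 0 := by simpa using h1 0
  have h20 : 1 - β / q ≠ 0 := by simpa using h2 0
  have hQ1 : 1 + Q ≠ 0 := by
    have := qp_ne (-Q) _ (by simpa using hQ) (by norm_num); simpa using this
  set y : ℕ → ℂ := fun n => c * (β * Q^n) / ((1 - q * (β * Q^n)) * (1 - β * Q^n / q)) with hy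
  set x : ℕ → ℂ := fun n => c * q * (β * Q^n) / (1 - q * (β * Q^n))^2 with hx
  have hysucc : ∀ n, y (n+1) = c * ((β * Q^n) * q^2) / ((1 - q^3 * (β * Q^n)) * (1 - q * (β * Q^n))) := by
    intro n
    have e1 : β * Q^(n+1) = (β * Q^n) * q^2 := by rw [pow_succ, hQd]; ring
    have e2 : q * ((β * Q^n) * q^2) = q^3 * (β * Q^n) := by ring
    have e3 : (β * Q^n) * q^2 / q = q * (β * Q^n) := by field_simp
    simp only [hy]
    rw [e1, e2, e3]
  have hy0 : y 0 = 1 := by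
    simp only [hy, pow_zero, mul_one, hcβ]; exact div_self (mul_ne_zero h10 h20)
  have m1 := (qp_one_sub _ _ (hqb 0)).2
  have m2 := (qp_one_sub _ _ (hbq 0)).2
  simp only [pow_zero, mul_one] at m1 m2
  have hyb : ∀ n, ‖y n‖ ≤ 2 * ‖Q‖^n := by
    intro n
    have : y n = ((1-β/q) * (1-q*β) / ((1 - β * Q^n / q) * (1 - q * (β * Q^n)))) * Q^n := by
      simp only [hy]; rw [← mul_assoc c, hcβ]; ring
    rw [this, norm_mul, norm_pow]
    gcongr
    have l2 := (qp_one_sub _ _ (hqb n)).1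
    have l3 := (qp_one_sub _ _ (hbq n)).1
    apply qp_quot <;> linarith
  have hxb : ∀ n, ‖x n‖ ≤ 1 := by
    intro n
    have : x n = ((1-β/q) * (1-q*β) / ((1 - q * (β * Q^n)) * (1 - q * (β * Q^n)))) * (q * Q^n) := by
      simp only [hx]
      have : c * q * (β * Q^n) = (1-q*β)*(1-β/q) * q * Q^n := by rw [← hcβ]; ring
      rw [this]; ring
    rw [this, norm_mul, norm_mul]
    have l2 := (qp_one_sub _ _ (hqb n)).1
    have l4 : ‖(1-β/q) * (1-q*β) / ((1 - q * (β * Q^n)) * (1 - q * (β * Q^n)))‖ ≤ 2 := by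
      apply qp_quot <;> linarith
    have l5 : ‖q‖ * ‖Q^n‖ ≤ 1/100 * 1 := by gcongr; exact hQn n
    calc _ ≤ (2:ℝ) * (1/100 * 1) := by gcongr
      _ ≤ 1 := by norm_num
  have hy1 : ∀ n, ‖y n‖ ≤ 1 := by
    intro n
    rcases n with _ | n
    · simp [hy0]
    · refine (hyb _).trans ?_
      rw [pow_succ]
      have := hQn n
      rw [norm_pow] at this
      have h0 : 0 ≤ ‖Q‖^n := by positivity
      nlinarith [norm_nonneg Q]
  have key := qp_tele ‖Q‖ (2 * (1 - 3 * ‖t‖)⁻¹) (norm_nonneg _) (by linarith) y x (fun y => t * y^2 * qpQ t 0 y)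
    (fun x => t * x^2 * qpQ t x 0) ?_ ?_ ?_
  · obtain ⟨k1, k2⟩ := key
    have hterm : ∀ n, (y n - y (n+1)) * x n = c^2 * q * (1 - Q) * qpSig0 (β * Q^n) q := by
      intro n
      rw [hysucc]
      exact qp_alg5 q (β * Q^n) c hq0 (h1 n) (h2 n) (h3 n)
    simp only [hy0, one_pow, mul_one] at k2
    rw [k2]
    simp only [hterm] at k1 ⊢
    rw [tsum_mul_left]
    have hc0 : c ≠ 0 := by
      rintro rfl; rw [zero_mul] at hcβ; exact mul_ne_zero h10 h20 hcβ.symm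
    have h1Q : 1 - Q ≠ 0 := qp_ne _ _ hQ (by norm_num)
    rw [summable_mul_left_iff (by simp [hc0, hq0, h1Q])] at k1
    rw [k1.tsum_eq_zero_add, ← tsum_mul_left]
    simp only [pow_zero, mul_one]
    congr 3
    funext n
    have e1 : β * Q^(n+1) = (β * q * Q^n) * q := by rw [pow_succ, hQd]; ring
    rw [e1]
    simp only [qpSig0, qpSig, mul_div_cancel_right₀ _ hq0]
    rw [hQd]
    rw [mul_div_assoc']
    congr 1
    · ring
    · ring
  · intro n
    rw [add_comm, mul_comm (y _)]
    refine qp_curve t _ _ ht3 (hxb n) (hy1 n) ?_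
    exact qp_alg3 q (β * Q^n) hq0 hQ1 (h1 n) (h2 n) c t _ _ hc ht rfl rfl
  · intro n
    rw [add_comm, mul_comm (y _)]
    refine qp_curve t _ _ ht3 (hxb n) (hy1 (n+1)) ?_
    exact qp_alg4 q (β * Q^n) hq0 hQ1 (h1 n) (h3 n) c t _ _ hc ht rfl (hysucc n)
  · intro n
    exact (qp_Rbound t (y n) ht3 (hy1 n) _ (hyb n)).2

theorem qp_base (q t c α β : ℂ) (hq0 : q ≠ 0) (hq : ‖q‖ ≤ 1/100) (hα : ‖α‖ ≤ 1/100) (hβ : ‖β‖ ≤ ‖q‖/10)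
    (ht : t = q / (1 + q^2)) (ht3 : ‖t‖ < 1/3) (hc : c = -(1-q^2)^2/q^2)
    (hcα : c * α = (1-α)^2) (hcβ : c * β = (1-q*β)*(1-β/q)) :
    qpQ t 1 1 = (1 - c^2 * q * (1 - q^2) * (qpTau α (q^2) + ∑' n, qpTau (α * q^2 * (q^2)^n) (q^2)
      + (qpSig0 β q + q^2 * ∑' n, qpSig (β * q * (q^2)^n) (q^2)))) / (1 - 3 * t) := by
  have h1 := qp_Rchain q t c α hq0 hq hα ht ht3 hc hcα
  have h2 := qp_Schain q t c β hq0 hq hβ ht ht3 hc hcβ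
  have h3 := qpQ_eq (x := 1) (y := 1) ht3 (by simp) (by simp)
  have h4 : 1 - 3 * t ≠ 0 := qp_ne _ (3 * ‖t‖) (by simp) (by linarith)
  rw [eq_div_iff h4, mul_add, ← h1, ← h2]
  linear_combination h3
/-- Principal square root. -/
noncomputable def qpSqrt (z : ℂ) : ℂ := z ^ (((2 : ℕ) : ℂ)⁻¹)

theorem qpSqrt_sq (z : ℂ) : qpSqrt z ^ 2 = z := Complex.cpow_nat_inv_pow z two_ne_zero

theorem qpSqrt_re (z : ℂ) (hz : z ∈ Complex.slitPlane) : 0 < (qpSqrt z).re := by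
  unfold qpSqrt
  have h0 : z ≠ 0 := Complex.slitPlane_ne_zero hz
  rw [Complex.cpow_def_of_ne_zero h0, Complex.exp_re]
  apply mul_pos (Real.exp_pos _)
  have h1 : (Complex.log z * ((2 : ℕ) : ℂ)⁻¹).im = z.arg / 2 := by
    rw [show ((2 : ℕ) : ℂ)⁻¹ = ((1/2 : ℝ) : ℂ) by push_cast; norm_num, Complex.im_mul_ofReal, Complex.log_im]
    ring
  rw [h1]
  have h2 := Complex.neg_pi_lt_arg z
  have h3 := Complex.arg_le_pi z
  have h4 := (Complex.mem_slitPlane_iff_arg.1 hz).1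
  have h5 : z.arg < Real.pi := lt_of_le_of_ne h3 h4
  apply Real.cos_pos_of_mem_Ioo
  constructor <;> linarith

theorem qpSqrt_an {f : ℂ → ℂ} {z : ℂ} (hf : AnalyticAt ℂ f z) (h : f z ∈ Complex.slitPlane) :
    AnalyticAt ℂ (fun z => qpSqrt (f z)) z := hf.cpow analyticAt_const h

/-- Nome squared. -/
noncomputable def qpNQ (z : ℂ) : ℂ := z^2 * (1 - z^2) / (1 + z^2)
/-- Nome. -/
noncomputable def qpNq (z : ℂ) : ℂ := -z * qpSqrt ((1 - z^2) / (1 + z^2))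
/-- Length variable. -/
noncomputable def qpT (z : ℂ) : ℂ := qpNq z / (1 + qpNQ z)
/-- Start of the first chain. -/
noncomputable def qpAl (z : ℂ) : ℂ := (z^2 - 1) / (z^2 * (z^2 + 1))
/-- Second point of the first chain. -/
noncomputable def qpB (z : ℂ) : ℂ := -(z^2 - 1)^2 / (1 + z^2)^2
/-- Normalizing constant. -/
noncomputable def qpC (z : ℂ) : ℂ := -(1 - qpNQ z)^2 / qpNQ z
/-- The argument of the inner root. -/
noncomputable def qpX (t : ℂ) : ℂ := ((1 - 2*t) * (1 + t)) / ((1 - 3*t) * (1 + 2*t))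
/-- Start of the second chain. -/
noncomputable def qpBe (z : ℂ) : ℂ := (1 - qpSqrt (qpX (qpT z))) / (1 + qpSqrt (qpX (qpT z)))
/-- The continued generating function. -/
noncomputable def qpG (z : ℂ) : ℂ :=
  (1 - qpC z^2 * qpNq z * (1 - qpNQ z) * (qpTau (qpAl z) (qpNQ z) + ∑' n, qpTau (qpB z * qpNQ z^n) (qpNQ z)
      + (qpSig0 (qpBe z) (qpNq z) + qpNQ z * ∑' n, qpSig (qpBe z * qpNq z * qpNQ z^n) (qpNQ z)))) / (1 - 3 * qpT z)

/-- The domain of continuation. -/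
def qpU : Set ℂ := {z | 0 ≤ z.re ∧ ∃ k : ℝ, z^2 = k ∧ 1 - √2 < k ∧ k < 1}

theorem qpU_conn : IsPreconnected qpU := by
  have h : StarConvex ℝ (0:ℂ) qpU := by
    intro z hz a b ha hb hab
    obtain ⟨h0, k, hk, hk1, hk2⟩ := hz
    have hb1 : b ≤ 1 := by linarith
    have h2 : 1 < √2 := by rw [Real.lt_sqrt] <;> norm_num
    refine ⟨by simp; positivity, b^2 * k, ?_, ?_, ?_⟩
    · simp [mul_pow, hk]
    · have : b^2 ≤ 1 := pow_le_one₀ hb hb1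
      have := sq_nonneg b
      rcases le_total k 0 with h | h <;> nlinarith
    · have : b^2 ≤ 1 := pow_le_one₀ hb hb1
      have := sq_nonneg b
      rcases le_total k 0 with h | h <;> nlinarith
  rcases qpU.eq_empty_or_nonempty with he | hne
  · rw [he]; exact isPreconnected_empty
  · have h2 : 1 < √2 := by rw [Real.lt_sqrt] <;> norm_num
    have h0 : (0:ℂ) ∈ qpU := ⟨by simp, 0, by simp, by linarith, by norm_num⟩
    exact (h.isPathConnected h0).isConnected.isPreconnected

theorem qpX_re (t : ℂ) (h : (t.im = 0 ∧ -(1/2) < t.re ∧ t.re ≤ 0) ∨ t.re = 0) :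
    0 < (qpX t).re ∧ 1 - 3*t ≠ 0 ∧ 1 + 2*t ≠ 0 := by
  have hne : 1 - 3*t ≠ 0 ∧ 1 + 2*t ≠ 0 := by
    constructor <;> intro h0 <;> have := congrArg Complex.re h0 <;> simp at this <;> rcases h with h | h <;> linarith
  refine ⟨?_, hne⟩
  unfold qpX
  have hD : 0 < Complex.normSq ((1 - 3*t) * (1 + 2*t)) := Complex.normSq_pos.2 (mul_ne_zero hne.1 hne.2)
  rw [Complex.div_re, ← add_div]
  apply div_pos _ hD
  rcases h with ⟨h, h1, h2⟩ | h
  · simp [h]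
    have : 0 < (1 - 2 * t.re) * (1 + t.re) := mul_pos (by linarith) (by linarith)
    have : 0 < (1 - 3 * t.re) * (1 + 2*t.re) := mul_pos (by linarith) (by linarith)
    positivity
  · simp [h]
    nlinarith [sq_nonneg t.im, sq_nonneg (t.im^2)]

/-- All pointwise facts on the domain. -/
structure qpOK (z : ℂ) (k : ℝ) : Prop where
  hz : z^2 = k
  k1 : 1 - √2 < k
  k2 : k < 1
  hk : (0:ℝ) < 1 + k
  hw : (1 - z^2) / (1 + z^2) ∈ Complex.slitPlane
  h1z : 1 + z^2 ≠ 0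
  hQ : qpNQ z = ((k * (1-k) / (1+k) : ℝ) : ℂ)
  hQ1 : ‖qpNQ z‖ < 1
  hQ1' : 1 + qpNQ z ≠ 0
  hX : qpX (qpT z) ∈ Complex.slitPlane
  h3t : 1 - 3 * qpT z ≠ 0
  h2t : 1 + 2 * qpT z ≠ 0

theorem qpNq_sq (z : ℂ) : qpNq z ^ 2 = qpNQ z := by
  unfold qpNq qpNQ
  rw [mul_pow, qpSqrt_sq]; ring

theorem qpSqrt_real (x : ℝ) (hx : 0 < x) : qpSqrt x = ((√x : ℝ) : ℂ) := by
  unfold qpSqrt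
  rw [Real.sqrt_eq_rpow, Complex.ofReal_cpow hx.le]
  norm_num

theorem qpU_ok (z : ℂ) (h0 : 0 ≤ z.re) (k : ℝ) (hz : z^2 = k) (k1 : 1 - √2 < k) (k2 : k < 1) : qpOK z k := by
  have s2 : √2 ^ 2 = 2 := Real.sq_sqrt (by norm_num)
  have s1 : 1 < √2 := by rw [Real.lt_sqrt] <;> norm_num
  have s3 : √2 < 2 := by rw [Real.sqrt_lt'] <;> norm_num
  have hk : 0 < 1 + k := by linarith
  have hwr : (1 - z^2) / (1 + z^2) = (((1-k)/(1+k) : ℝ) : ℂ) := by rw [hz]; push_cast; rfl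
  have hwpos : 0 < (1-k)/(1+k) := div_pos (by linarith) hk
  have h1z : 1 + z^2 ≠ 0 := by
    rw [hz]; exact_mod_cast hk.ne'
  have hQ : qpNQ z = ((k * (1-k) / (1+k) : ℝ) : ℂ) := by
    unfold qpNQ; rw [hz]; push_cast; rfl
  have hQr : |k * (1-k) / (1+k)| < 1 := by
    rw [abs_lt, lt_div_iff₀ hk, div_lt_iff₀ hk]
    constructor <;> nlinarith
  have hQ1 : ‖qpNQ z‖ < 1 := by
    rw [hQ, Complex.norm_real]; exact hQr
  have hQp : 0 < 1 + k * (1-k) / (1+k) := by linarith [(abs_lt.1 hQr).1]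
  have hQ1' : 1 + qpNQ z ≠ 0 := by rw [hQ]; exact_mod_cast hQp.ne'
  have hT : qpT z = -z * ((√((1-k)/(1+k)) / (1 + k * (1-k) / (1+k)) : ℝ) : ℂ) := by
    unfold qpT qpNq
    rw [hQ, hwr, qpSqrt_real _ hwpos]; push_cast; ring
  have hTsq : qpT z^2 = ((k * (1-k) / (1+k)) / (1 + k * (1-k) / (1+k))^2 : ℝ) := by
    unfold qpT; rw [div_pow, qpNq_sq, hQ]; push_cast; rfl
  have hpos : 0 < √((1-k)/(1+k)) / (1 + k * (1-k) / (1+k)) := div_pos (Real.sqrt_pos.2 hwpos) hQp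
  have hcase : ((qpT z).im = 0 ∧ -(1/2) < (qpT z).re ∧ (qpT z).re ≤ 0) ∨ (qpT z).re = 0 := by
    have him := congrArg Complex.im hz
    simp only [pow_two, Complex.mul_im, Complex.ofReal_im] at him
    have : z.re * z.im = 0 := by linarith
    rcases mul_eq_zero.1 this with h | h
    · right
      rw [hT, Complex.re_mul_ofReal]; simp [h]
    · left
      have hi : (qpT z).im = 0 := by rw [hT, Complex.im_mul_ofReal]; simp [h]
      have hr : (qpT z).re ≤ 0 := by
        rw [hT, Complex.re_mul_ofReal]; simp only [Complex.neg_re]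
        nlinarith
      refine ⟨hi, ?_, hr⟩
      have h1 := congrArg Complex.re hTsq
      simp only [pow_two, Complex.mul_re, Complex.ofReal_re, hi, mul_zero, sub_zero] at h1
      set Q := k * (1-k) / (1+k)
      have h2 : Q / ((1+Q)*(1+Q)) < 1/4 := by
        rw [div_lt_iff₀ (by positivity)]
        nlinarith [sq_nonneg (1 - Q), (abs_lt.1 hQr).2, mul_pos (sub_pos.2 (abs_lt.1 hQr).2) (sub_pos.2 (abs_lt.1 hQr).2)]
      rw [← h1] at h2
      nlinarith
  obtain ⟨x1, x2, x3⟩ := qpX_re _ hcase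
  exact ⟨hz, k1, k2, hk, by rw [hwr]; exact Complex.ofReal_mem_slitPlane.2 hwpos, h1z, hQ, hQ1, hQ1', Or.inl x1, x2, x3⟩

theorem qpNQ_an {z : ℂ} (h : 1 + z^2 ≠ 0) : AnalyticAt ℂ qpNQ z := by
  unfold qpNQ
  exact AnalyticAt.div (by fun_prop) (by fun_prop) h

theorem qpB_an {z : ℂ} (h : 1 + z^2 ≠ 0) : AnalyticAt ℂ qpB z := by
  unfold qpB
  exact AnalyticAt.div (by fun_prop) (by fun_prop) (pow_ne_zero _ h)

theorem qpAl_an {z : ℂ} (h : 1 + z^2 ≠ 0) (h0 : z ≠ 0) : AnalyticAt ℂ qpAl z := by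
  unfold qpAl
  exact AnalyticAt.div (by fun_prop) (by fun_prop) (mul_ne_zero (pow_ne_zero _ h0) (by rwa [add_comm]))

theorem qpAl_mero (z : ℂ) : MeromorphicAt qpAl z := by
  unfold qpAl
  fun_prop

theorem qpNq_an {z : ℂ} {k : ℝ} (h : qpOK z k) : AnalyticAt ℂ qpNq z := by
  unfold qpNq
  refine AnalyticAt.mul (by fun_prop) (qpSqrt_an ?_ h.hw)
  exact AnalyticAt.div (by fun_prop) (by fun_prop) h.h1z

theorem qpT_an {z : ℂ} {k : ℝ} (h : qpOK z k) : AnalyticAt ℂ qpT z := by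
  have h1 := qpNq_an h
  have h2 := qpNQ_an h.h1z
  unfold qpT
  exact AnalyticAt.div h1 (by fun_prop) h.hQ1'

theorem qpS_re {z : ℂ} {k : ℝ} (h : qpOK z k) : 0 < (qpSqrt (qpX (qpT z))).re := qpSqrt_re _ h.hX

theorem qpS_ne {z : ℂ} {k : ℝ} (h : qpOK z k) : 1 + qpSqrt (qpX (qpT z)) ≠ 0 := by
  intro h0
  have := congrArg Complex.re h0
  simp at this
  linarith [qpS_re h]

theorem qpS_an {z : ℂ} {k : ℝ} (h : qpOK z k) : AnalyticAt ℂ (fun z => qpSqrt (qpX (qpT z))) z := by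
  have h1 := qpT_an h
  refine qpSqrt_an ?_ h.hX
  unfold qpX
  exact AnalyticAt.div (by fun_prop) (by fun_prop) (mul_ne_zero h.h3t h.h2t)

theorem qpBe_an {z : ℂ} {k : ℝ} (h : qpOK z k) : AnalyticAt ℂ qpBe z := by
  have h1 := qpS_an h
  unfold qpBe
  exact AnalyticAt.div (by fun_prop) (by fun_prop) (qpS_ne h)

theorem qpBe_norm {z : ℂ} {k : ℝ} (h : qpOK z k) : ‖qpBe z‖ < 1 := by
  have hs := qpS_re h
  unfold qpBe
  set s := qpSqrt (qpX (qpT z))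
  rw [norm_div, div_lt_one (norm_pos_iff.2 (qpS_ne h))]
  rw [← sq_lt_sq₀ (norm_nonneg _) (norm_nonneg _), ← Complex.normSq_eq_norm_sq, ← Complex.normSq_eq_norm_sq,
    Complex.normSq_apply, Complex.normSq_apply]
  simp
  nlinarith

theorem qpNq_norm {z : ℂ} {k : ℝ} (h : qpOK z k) : ‖qpNq z‖ < 1 := by
  have h1 := h.hQ1
  rw [← qpNq_sq, norm_pow] at h1
  exact (pow_lt_one_iff_of_nonneg (norm_nonneg _) two_ne_zero).1 h1

theorem qpNQ_mero (z : ℂ) : MeromorphicAt qpNQ z := by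
  unfold qpNQ; fun_prop

theorem qpC_mero (z : ℂ) : MeromorphicAt qpC z := by
  have := qpNQ_mero z
  unfold qpC; fun_prop

theorem qpG_mero {z : ℂ} {k : ℝ} (h : qpOK z k) : MeromorphicAt qpG z := by
  have h1 := qpNQ_an h.h1z
  have h2 := qpB_an h.h1z
  have h3 := qpNq_an h
  have h4 := qpBe_an h
  have h5 := qpT_an h
  have m1 := h1.meromorphicAt
  have m2 := h2.meromorphicAt
  have m3 := h3.meromorphicAt
  have m4 := h4.meromorphicAt
  have m5 := h5.meromorphicAt
  have m6 := qpC_mero z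
  have m7 := qpTau_mero (qpAl_mero z) m1
  have m8 : MeromorphicAt (fun z => qpSig0 (qpBe z) (qpNq z)) z := by
    unfold qpSig0; fun_prop
  have m9 : MeromorphicAt (fun z => ∑' n, qpTau (qpB z * qpNQ z^n) (qpNQ z)) z := by
    refine qp_sum_mero qpTau qpB qpNQ z h2 h1 h.hQ1 (qpTau_an _ _ (by simp) (by simp)) (by simp [qpTau]) ?_
    intro n
    exact qpTau_mero (by fun_prop) m1
  have m10 : MeromorphicAt (fun z => ∑' n, qpSig (qpBe z * qpNq z * qpNQ z^n) (qpNQ z)) z := by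
    refine qp_sum_mero qpSig (fun z => qpBe z * qpNq z) qpNQ z (h4.mul h3) h1 h.hQ1 (qpSig_an _ _ (by simp) (by simp) (by simp)) (by simp [qpSig]) ?_
    intro n
    exact qpSig_mero (by fun_prop) m1
  unfold qpG
  fun_prop

theorem qp_rel_be (q t c s : ℂ) (hq : q ≠ 0) (hQ : 1 + q^2 ≠ 0) (ht : t = q / (1+q^2)) (hc : c = -(1-q^2)^2/q^2)
    (h3 : 1 - 3 * t ≠ 0) (h2 : 1 + 2*t ≠ 0) (hs : s^2 = qpX t) (hs1 : 1 + s ≠ 0) :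
    c * ((1-s)/(1+s)) = (1 - q * ((1-s)/(1+s))) * (1 - ((1-s)/(1+s))/q) := by
  have e3 : 1 + q^2 - 3*q ≠ 0 := by
    intro h0; apply h3; rw [ht]; field_simp; rw [mul_zero]; exact h0
  have e2 : 1 + q^2 + 2*q ≠ 0 := by
    intro h0; apply h2; rw [ht]; field_simp; rw [mul_zero]; exact h0
  have hX : s^2 * ((1 + q^2 - 3*q) * (1 + q^2 + 2*q)) = (1 + q^2 - 2*q) * (1 + q^2 + q) := by
    rw [hs, qpX, ht]
    have e4 : 1 + q^2 - q*3 ≠ 0 := by rwa [mul_comm] at e3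
    field_simp
  subst hc
  field_simp
  linear_combination hX

theorem qp_rel_al {z : ℂ} (h : 1 + z^2 ≠ 0) (h0 : z ≠ 0) (h1 : 1 - z^2 ≠ 0) : qpC z * qpAl z = (1 - qpAl z)^2 := by
  unfold qpC qpAl qpNQ
  have h2 : z^2 + 1 ≠ 0 := by rwa [add_comm] at h
  field_simp
  ring

theorem qp_al_b {z : ℂ} (h : 1 + z^2 ≠ 0) (h0 : z ≠ 0) : qpAl z * qpNQ z = qpB z := by
  unfold qpAl qpNQ qpB
  have h2 : z^2 + 1 ≠ 0 := by rwa [add_comm] at h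
  field_simp
  ring

theorem qpBe_rel {z : ℂ} {k : ℝ} (h : qpOK z k) (hq : qpNq z ≠ 0) :
    qpC z * qpBe z = (1 - qpNq z * qpBe z) * (1 - qpBe z / qpNq z) := by
  have hQ := h.hQ1'
  rw [← qpNq_sq] at hQ
  exact qp_rel_be (qpNq z) (qpT z) (qpC z) _ hq hQ (by rw [qpNq_sq]; rfl) (by rw [qpNq_sq]; rfl) h.h3t h.h2t (qpSqrt_sq _) (qpS_ne h)

theorem qpBe_small {z : ℂ} {k : ℝ} (h : qpOK z k) (ht : ‖qpT z‖ ≤ 1/100) : ‖qpBe z‖ ≤ 8 * ‖qpT z‖^2 := by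
  have hs := qpS_re h
  have hne := qpS_ne h
  have hsq := qpSqrt_sq (qpX (qpT z))
  have h3 := h.h3t
  have h2 := h.h2t
  unfold qpBe
  set s := qpSqrt (qpX (qpT z))
  set t := qpT z
  have e : (1 - s) / (1 + s) = (-4 * t^2) / (((1 - 3*t) * (1 + 2*t)) * (1+s)^2) := by
    rw [div_eq_div_iff hne (by positivity)]
    have : s^2 * ((1 - 3*t) * (1 + 2*t)) = (1 - 2*t) * (1 + t) := by
      rw [hsq, qpX, div_mul_cancel₀ _ (mul_ne_zero h3 h2)]
    linear_combination (-(1 + s)) * this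
  have g1 := (qp_one_sub (3*t) (3/100) (by simp; linarith)).1
  have g2 := (qp_one_sub (-(2*t)) (2/100) (by simp; linarith)).1
  rw [sub_neg_eq_add] at g2
  have g3 : 1 ≤ ‖1 + s‖ := by
    have := Complex.re_le_norm (1 + s)
    simp at this; linarith
  rw [e, norm_div, norm_mul, norm_mul, norm_mul, norm_pow, norm_pow, div_le_iff₀ (by positivity)]
  have g4 : 1/2 ≤ ‖1 - 3*t‖ * ‖1 + 2*t‖ := by
    calc (1/2:ℝ) ≤ (1 - 3/100) * (1 - 2/100) := by norm_num
      _ ≤ _ := by gcongr <;> norm_num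
  have g5 : 1 ≤ ‖1 + s‖^2 := one_le_pow₀ g3
  have g6 : 1/2 * 1 ≤ ‖1 - 3*t‖ * ‖1 + 2*t‖ * ‖1 + s‖^2 := by gcongr
  have : ‖(-4:ℂ)‖ = 4 := by simp
  rw [this]
  nlinarith [sq_nonneg ‖t‖]

/-- The base point. -/
noncomputable def qpZ0 : ℂ := ((√(1 - 1/100000) : ℝ) : ℂ)

theorem qpZ0_ok : qpZ0 ∈ qpU ∧ qpOK qpZ0 (1 - 1/100000) := by
  have s1 : 1 < √2 := by rw [Real.lt_sqrt] <;> norm_num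
  have hz : qpZ0^2 = ((1 - 1/100000 : ℝ) : ℂ) := by
    unfold qpZ0; rw [← Complex.ofReal_pow, Real.sq_sqrt (by norm_num)]
  have hr : 0 ≤ qpZ0.re := by unfold qpZ0; rw [Complex.ofReal_re]; positivity
  exact ⟨⟨hr, _, hz, by linarith, by norm_num⟩, qpU_ok _ hr _ hz (by linarith) (by norm_num)⟩

theorem qpZ0_base : ‖qpT qpZ0‖ < 1/3 ∧ qpG =ᶠ[𝓝 qpZ0] fun z => qpQ (qpT z) 1 1 := by
  have h := qpZ0_ok.2
  have hQv := h.hQ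
  have hQn : ‖qpNQ qpZ0‖ < (1/100)^2 := by
    rw [hQv, Complex.norm_real]; norm_num [abs_lt]
  have hqn : ‖qpNq qpZ0‖ < 1/100 := by
    rw [← qpNq_sq, norm_pow] at hQn
    exact lt_of_pow_lt_pow_left₀ 2 (by norm_num) hQn
  have hz2 := h.hz
  have hz0 : qpZ0 ≠ 0 := by
    intro h0; rw [h0] at hz2
    have := congrArg Complex.re hz2
    norm_num at this
  have hQ0 : qpNQ qpZ0 ≠ 0 := by
    rw [hQv]; norm_num
  have hq0 : qpNq qpZ0 ≠ 0 := by
    intro h0; apply hQ0; rw [← qpNq_sq, h0]; simp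
  have hTn : ‖qpT qpZ0‖ ≤ ‖qpNq qpZ0‖ := by
    unfold qpT
    rw [norm_div]
    apply div_le_self (norm_nonneg _)
    have := Complex.re_le_norm (1 + qpNQ qpZ0)
    rw [hQv] at this ⊢
    rw [Complex.add_re, Complex.ofReal_re, Complex.one_re] at this
    refine le_trans ?_ this
    norm_num
  have hBn : ‖qpBe qpZ0‖ < ‖qpNq qpZ0‖ / 10 := by
    refine (qpBe_small h (by linarith)).trans_lt ?_
    have hp : 0 < ‖qpNq qpZ0‖ := norm_pos_iff.2 hq0
    nlinarith [norm_nonneg (qpT qpZ0)]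
  have hAn : ‖qpAl qpZ0‖ < 1/100 := by
    unfold qpAl; rw [hz2]
    have : (((1 - 1/100000 : ℝ) : ℂ) - 1) / (((1 - 1/100000 : ℝ) : ℂ) * (((1 - 1/100000 : ℝ) : ℂ) + 1)) =
      (((1 - 1/100000 : ℝ) - 1) / ((1 - 1/100000 : ℝ) * ((1 - 1/100000 : ℝ) + 1)) : ℝ) := by push_cast; rfl
    rw [this, Complex.norm_real]
    norm_num [abs_lt]
  have h1z : 1 - qpZ0^2 ≠ 0 := by rw [hz2]; norm_num
  have hT3 : ‖qpT qpZ0‖ < 1/3 := by linarith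
  refine ⟨hT3, ?_⟩
  have cQ := (qpNQ_an h.h1z).continuousAt
  have cq := (qpNq_an h).continuousAt
  have cT := (qpT_an h).continuousAt
  have cA := (qpAl_an h.h1z hz0).continuousAt
  have cB := (qpBe_an h).continuousAt
  have cS := (qpS_an h).continuousAt
  have cid : ContinuousAt (fun z : ℂ => z) qpZ0 := continuousAt_id
  have e1 : ∀ᶠ z in 𝓝 qpZ0, z ≠ 0 := cid.eventually_ne hz0
  have e2 : ∀ᶠ z in 𝓝 qpZ0, 1 + z^2 ≠ 0 := (ContinuousAt.eventually_ne (by fun_prop) h.h1z)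
  have e3 : ∀ᶠ z in 𝓝 qpZ0, 1 - z^2 ≠ 0 := (ContinuousAt.eventually_ne (by fun_prop) h1z)
  have e4 : ∀ᶠ z in 𝓝 qpZ0, qpNq z ≠ 0 := cq.eventually_ne hq0
  have e5 : ∀ᶠ z in 𝓝 qpZ0, 1 + qpNQ z ≠ 0 := (ContinuousAt.eventually_ne (by fun_prop) h.hQ1')
  have e6 : ∀ᶠ z in 𝓝 qpZ0, 1 - 3 * qpT z ≠ 0 := (ContinuousAt.eventually_ne (by fun_prop) h.h3t)
  have e7 : ∀ᶠ z in 𝓝 qpZ0, 1 + 2 * qpT z ≠ 0 := (ContinuousAt.eventually_ne (by fun_prop) h.h2t)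
  have e8 : ∀ᶠ z in 𝓝 qpZ0, 1 + qpSqrt (qpX (qpT z)) ≠ 0 := (ContinuousAt.eventually_ne (by fun_prop) (qpS_ne h))
  have e9 : ∀ᶠ z in 𝓝 qpZ0, ‖qpNq z‖ < 1/100 := cq.norm.eventually (gt_mem_nhds hqn)
  have e10 : ∀ᶠ z in 𝓝 qpZ0, ‖qpAl z‖ < 1/100 := cA.norm.eventually (gt_mem_nhds hAn)
  have e11 : ∀ᶠ z in 𝓝 qpZ0, ‖qpT z‖ < 1/3 := cT.norm.eventually (gt_mem_nhds hT3)
  have e12 : ∀ᶠ z in 𝓝 qpZ0, ‖qpBe z‖ < ‖qpNq z‖ / 10 := cB.norm.eventually_lt (cq.norm.div_const 10) hBn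
  filter_upwards [e1, e2, e3, e4, e5, e6, e7, e8, e9, e10, e11, e12] with z e1 e2 e3 e4 e5 e6 e7 e8 e9 e10 e11 e12
  have hb := qp_base (qpNq z) (qpT z) (qpC z) (qpAl z) (qpBe z) e4 e9.le e10.le e12.le (by rw [qpNq_sq]; rfl) e11
    (by rw [qpNq_sq]; rfl) (qp_rel_al e2 e1 e3)
    (qp_rel_be (qpNq z) (qpT z) (qpC z) _ e4 (by rwa [qpNq_sq]) (by rw [qpNq_sq]; rfl) (by rw [qpNq_sq]; rfl) e6 e7 (qpSqrt_sq _) e8)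
  rw [hb, qpNq_sq, qp_al_b e2 e1]
  rfl

theorem qpT_deriv {z : ℂ} {k : ℝ} (h : qpOK z k) (hz0 : z ≠ 0) (hk : 1 - 2*k - k^2 ≠ 0) : deriv qpT z ≠ 0 := by
  intro h0
  have dT : HasDerivAt qpT 0 z := by rw [← h0]; exact (qpT_an h).differentiableAt.hasDerivAt
  have dQ := (qpNQ_an h.h1z).differentiableAt.hasDerivAt
  set Q' := deriv qpNQ z
  have hQne : qpNQ z ≠ 1 := by intro h1; have := h.hQ1; rw [h1] at this; simp at this
  have f1 : (fun z => qpT z^2 * (1 + qpNQ z)^2) =ᶠ[𝓝 z] qpNQ := by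
    have : ∀ᶠ z in 𝓝 z, 1 + qpNQ z ≠ 0 := ContinuousAt.eventually_ne (by have := (qpNQ_an h.h1z).continuousAt; fun_prop) h.hQ1'
    filter_upwards [this] with w hw
    unfold qpT; rw [div_pow, div_mul_cancel₀ _ (pow_ne_zero _ hw), qpNq_sq]
  have f2 : (fun z => qpNQ z * (1 + z^2)) =ᶠ[𝓝 z] fun z => z^2 * (1 - z^2) := by
    have : ∀ᶠ z in 𝓝 z, 1 + z^2 ≠ 0 := ContinuousAt.eventually_ne (by fun_prop) h.h1z
    filter_upwards [this] with w hw
    unfold qpNQ; rw [div_mul_cancel₀ _ hw]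
  have d1 := ((dT.fun_pow 2).fun_mul ((dQ.const_add 1).fun_pow 2)).congr_of_eventuallyEq f1.symm
  have u1 := d1.unique dQ
  have d2 := (dQ.fun_mul (((hasDerivAt_id' z).fun_pow 2).const_add 1)).congr_of_eventuallyEq f2.symm
  have u2 := d2.unique (((hasDerivAt_id' z).fun_pow 2).fun_mul (((hasDerivAt_id' z).fun_pow 2).const_sub 1))
  have hTs : qpT z^2 * (1 + qpNQ z)^2 = qpNQ z := f1.self_of_nhds
  have hQs : qpNQ z * (1 + z^2) = z^2 * (1 - z^2) := f2.self_of_nhds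
  simp at u1 u2
  have hQ1 := h.hQ1'
  have hQ' : Q' = 0 := by
    have : Q' * (qpNQ z - 1) = 0 := by
      linear_combination (1 + qpNQ z) * u1 - 2 * Q' * hTs
    exact (mul_eq_zero.1 this).resolve_right (sub_ne_zero.2 hQne)
  rw [hQ'] at u2
  have h3 : z * (1 - 2 * z^2 - (z^2)^2) = 0 := by
    linear_combination (-(1 + z^2)/2) * u2 + z * hQs
  have h4 := (mul_eq_zero.1 h3).resolve_left hz0
  rw [h.hz] at h4
  exact hk (by exact_mod_cast h4)

theorem qp_order_neg (G a P H : ℂ → ℂ) (z0 : ℂ) (hG : MeromorphicAt G z0)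
    (ha : ContinuousAt a z0) (hP : ContinuousAt P z0) (hH : ContinuousAt H z0) (ha1 : a z0 = 1) (hP0 : P z0 ≠ 0)
    (hane : ∀ᶠ z in 𝓝[≠] z0, a z ≠ 1)
    (h : ∀ᶠ z in 𝓝[≠] z0, a z ≠ 1 → G z = P z / (1 - a z)^3 + H z) : meromorphicOrderAt G z0 < 0 := by
  by_contra hcon
  rw [not_lt] at hcon
  obtain ⟨c, hc⟩ := (tendsto_nhds_iff_meromorphicOrderAt_nonneg hG).2 hcon
  have l1 : Tendsto (fun z => (1 - a z)^3 * G z) (𝓝[≠] z0) (𝓝 ((1 - a z0)^3 * c)) :=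
    ((continuousAt_const.sub ha).pow 3).continuousWithinAt.tendsto.mul hc
  have l2 : Tendsto (fun z => P z + (1 - a z)^3 * H z) (𝓝[≠] z0) (𝓝 (P z0 + (1 - a z0)^3 * H z0)) :=
    (hP.add (((continuousAt_const.sub ha).pow 3).mul hH)).continuousWithinAt.tendsto
  have l3 : (fun z => (1 - a z)^3 * G z) =ᶠ[𝓝[≠] z0] (fun z => P z + (1 - a z)^3 * H z) := by
    filter_upwards [hane, h] with z h1 h2
    rw [h2 h1]
    have : 1 - a z ≠ 0 := sub_ne_zero.2 h1.symm
    field_simp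
  have := tendsto_nhds_unique (l1.congr' l3) l2
  rw [ha1] at this
  simp at this
  exact hP0 this.symm

theorem qp_pole {z : ℂ} (hzU : z ∈ qpU) {k : ℝ} (h : qpOK z k) (hz0 : z ≠ 0) (m : ℕ) (hm : qpB z * qpNQ z ^ (m+1) = 1) :
    meromorphicOrderAt qpG z < 0 := by
  have hQ1 := h.hQ1
  have hz1 : 1 - z^2 ≠ 0 := by
    rw [h.hz]; intro h0
    have h2 : 1 - k = 0 := by exact_mod_cast h0
    linarith [h.k2]
  have hQ0 : qpNQ z ≠ 0 := by
    intro h0; rw [h0] at hm; simp at hm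
  have hq0 : qpNq z ≠ 0 := by
    intro h0; apply hQ0; rw [← qpNq_sq, h0]; simp
  have hQne : 1 - qpNQ z ≠ 0 := by
    intro h1; rw [← sub_eq_zero.1 h1] at hQ1; simp at hQ1
  have hpow : ∀ n : ℕ, 0 < n → qpNQ z ^ n ≠ 1 := by
    intro n hn h
    have := congrArg norm h
    rw [norm_pow, norm_one] at this
    exact (pow_lt_one₀ (norm_nonneg _) hQ1 hn.ne').ne this
  have hb1 : qpB z ≠ 1 := by
    intro h1; rw [h1, one_mul] at hm; exact hpow _ (by omega) hm
  have hA1 : qpAl z ≠ 1 := by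
    intro h1
    have := qp_al_b h.h1z hz0
    rw [h1, one_mul] at this
    rw [← this, ← pow_succ'] at hm
    exact hpow _ (by omega) hm
  have aQ := qpNQ_an h.h1z
  have aB := qpB_an h.h1z
  have aq := qpNq_an h
  have aBe := qpBe_an h
  have aT := qpT_an h
  have aA := qpAl_an h.h1z hz0
  have hBe := qpBe_norm h
  have hqn := qpNq_norm h
  have aC : AnalyticAt ℂ qpC z := by
    unfold qpC; exact AnalyticAt.div (by fun_prop) aQ hQ0
  have hC0 : qpC z ≠ 0 := by
    unfold qpC; exact div_ne_zero (neg_ne_zero.2 (pow_ne_zero _ hQne)) hQ0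
  have lt_ne : ∀ w : ℂ, ‖w‖ < 1 → 1 - w ≠ 0 := by
    intro w hw h0; rw [← sub_eq_zero.1 h0] at hw; simp at hw
  have n1 : ‖qpNq z * qpBe z‖ < 1 := by
    rw [norm_mul]; nlinarith [norm_nonneg (qpNq z), norm_nonneg (qpBe z)]
  have n2 : ∀ n : ℕ, ‖qpBe z * qpNq z * qpNQ z ^ n‖ < 1 := by
    intro n
    rw [norm_mul, mul_comm (qpBe z), norm_pow]
    have : ‖qpNQ z‖^n ≤ 1 := pow_le_one₀ (norm_nonneg _) hQ1.le
    have h0 : 0 ≤ ‖qpNQ z‖^n := by positivity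
    nlinarith [norm_nonneg (qpNq z * qpBe z)]
  have aSig0 : AnalyticAt ℂ (fun z => qpSig0 (qpBe z) (qpNq z)) z := by
    unfold qpSig0
    refine AnalyticAt.div (by fun_prop) (((AnalyticAt.pow (by fun_prop) _).mul
      (analyticAt_const.sub (AnalyticAt.div aBe aq hq0))).mul (by fun_prop)) ?_
    refine mul_ne_zero (mul_ne_zero (pow_ne_zero _ (lt_ne _ n1)) ?_) (lt_ne _ ?_)
    · intro h0
      have := qpBe_rel h hq0
      rw [h0, mul_zero] at this
      have hb0 := (mul_eq_zero.1 this).resolve_left hC0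
      rw [hb0] at h0; simp at h0
    · have : qpNq z^3 * qpBe z = qpBe z * qpNq z * qpNQ z^1 := by rw [← qpNq_sq]; ring
      rw [this]; exact n2 1
  have aSig : AnalyticAt ℂ (fun z => ∑' n, qpSig (qpBe z * qpNq z * qpNQ z^n) (qpNQ z)) z := by
    refine qp_sum_an qpSig (fun z => qpBe z * qpNq z) qpNQ z (aBe.mul aq) aQ hQ1 (qpSig_an _ _ (by simp) (by simp) (by simp)) (by simp [qpSig]) ?_
    intro n
    refine qpSig_an' (fun z => qpBe z * qpNq z * qpNQ z^n) qpNQ z (by fun_prop) aQ ?_ ?_ ?_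
    · intro h0
      refine lt_ne _ (n2 (n+1)) (sub_eq_zero.2 ?_)
      rw [← h0]; ring
    · intro h0
      exact lt_ne _ (n2 n) (sub_eq_zero.2 h0.symm)
    · intro h0
      refine lt_ne _ (n2 (n+2)) (sub_eq_zero.2 ?_)
      rw [← h0]; ring
  have aTau : AnalyticAt ℂ (fun z => qpTau (qpAl z) (qpNQ z)) z :=
    qpTau_an' qpAl qpNQ z aA aQ hA1 (by rw [qp_al_b h.h1z hz0]; exact hb1)
  obtain ⟨E, hE, hE0, hEq⟩ := qpTau_pole qpB qpNQ z aB aQ hQ1 hQ0 m hm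
  have h3t := h.h3t
  have cQ := aQ.continuousAt
  have cB := aB.continuousAt
  have cq := aq.continuousAt
  have cT := aT.continuousAt
  have cC := aC.continuousAt
  have cE := hE.continuousAt
  have c1 := aSig0.continuousAt
  have c2 := aSig.continuousAt
  have c3 := aTau.continuousAt
  have aa : ∀ w ∈ qpU, AnalyticAt ℂ (fun z => qpB z * qpNQ z ^ (m+1)) w := by
    rintro w ⟨hw0, k', hk', hk1, hk2⟩
    have ok := qpU_ok w hw0 k' hk' hk1 hk2
    exact (qpB_an ok.h1z).mul ((qpNQ_an ok.h1z).pow _)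
  have hane : ∀ᶠ w in 𝓝[≠] z, qpB w * qpNQ w ^ (m+1) ≠ 1 := by
    rcases (aa z hzU).eventually_eq_or_eventually_ne (analyticAt_const (v := (1:ℂ))) with h1 | h1
    · exfalso
      have s1 : 1 < √2 := by rw [Real.lt_sqrt] <;> norm_num
      have h0U : (0:ℂ) ∈ qpU := ⟨by simp, 0, by simp, by linarith, by norm_num⟩
      have := AnalyticOnNhd.eqOn_of_preconnected_of_eventuallyEq (fun w hw => aa w hw)
        (fun w _ => analyticAt_const) qpU_conn hzU h1 h0U
      simp [qpNQ] at this
    · exact h1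
  refine qp_order_neg qpG (fun z => qpB z * qpNQ z ^ (m+1))
    (fun z => -(qpC z^2 * qpNq z * (1 - qpNQ z)) * E z / (1 - 3 * qpT z))
    (fun z => (1 - qpC z^2 * qpNq z * (1 - qpNQ z) * (qpTau (qpAl z) (qpNQ z)
      + (qpSig0 (qpBe z) (qpNq z) + qpNQ z * ∑' n, qpSig (qpBe z * qpNq z * qpNQ z^n) (qpNQ z)))) / (1 - 3 * qpT z))
    z (qpG_mero h) (by fun_prop) (ContinuousAt.div (by fun_prop) (by fun_prop) h3t)
    (ContinuousAt.div (by fun_prop) (by fun_prop) h3t) hm ?_ hane ?_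
  · refine div_ne_zero (mul_ne_zero (neg_ne_zero.2 ?_) hE0) h3t
    exact mul_ne_zero (mul_ne_zero (pow_ne_zero _ hC0) hq0) hQne
  · filter_upwards [hEq] with w h1 h2
    unfold qpG
    rw [h1 h2]
    ring

theorem qp_exists_pole (m : ℕ) : ∃ k : ℝ, 1 - √2 < k ∧ k < 0 ∧
    -(k - 1)^2 / (1+k)^2 * (k * (1-k) / (1+k)) ^ (2*m+1) = 1 := by
  have s2 : √2 ^ 2 = 2 := Real.sq_sqrt (by norm_num)
  have s1 : 1 < √2 := by rw [Real.lt_sqrt] <;> norm_num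
  have s3 : √2 < 3/2 := by rw [Real.sqrt_lt'] <;> norm_num
  set f : ℝ → ℝ := fun k => -(k - 1)^2 / (1+k)^2 * (k * (1-k) / (1+k)) ^ (2*m+1) with hf
  have hcont : ContinuousOn f (Set.Icc (1 - √2) 0) := by
    have : ∀ k ∈ Set.Icc (1-√2) 0, 1 + k ≠ 0 := by
      intro k hk; have := hk.1; intro h0; linarith
    refine ContinuousOn.mul (ContinuousOn.div (by fun_prop) (by fun_prop) fun k hk => pow_ne_zero _ (this k hk)) ?_
    exact ContinuousOn.pow (ContinuousOn.div (by fun_prop) (by fun_prop) this) _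
  have f0 : f 0 = 0 := by simp [hf]
  have f1 : 1 < f (1 - √2) := by
    have e : (1 - √2) * (1 - (1 - √2)) / (1 + (1 - √2)) = -1 := by
      rw [div_eq_iff (by linarith)]; nlinarith
    simp only [hf]
    rw [e, Odd.neg_one_pow ⟨m, rfl⟩, mul_neg_one, neg_div, neg_neg, one_lt_div (by apply pow_pos; linarith)]
    nlinarith
  obtain ⟨k, hk, hk1⟩ := intermediate_value_Icc' (by linarith) hcont ⟨by rw [f0]; norm_num, f1.le⟩
  refine ⟨k, lt_of_le_of_ne hk.1 ?_, lt_of_le_of_ne hk.2 ?_, hk1⟩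
  · rintro rfl; linarith
  · rintro rfl; linarith

/-- Parameter of the pole. -/
noncomputable def qpPk (m : ℕ) : ℝ := (qp_exists_pole m).choose
/-- The poles. -/
noncomputable def qpPz (m : ℕ) : ℂ := Complex.I * ((√(-qpPk m) : ℝ) : ℂ)

theorem qpPz_ok (m : ℕ) : qpPz m ∈ qpU ∧ qpOK (qpPz m) (qpPk m) ∧ qpPz m ≠ 0 ∧
    qpB (qpPz m) * qpNQ (qpPz m) ^ (2*m+1) = 1 := by
  obtain ⟨h1, h2, h3⟩ := (qp_exists_pole m).choose_spec
  change 1 - √2 < qpPk m at h1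
  change qpPk m < 0 at h2
  change -(qpPk m - 1)^2 / (1+qpPk m)^2 * (qpPk m * (1-qpPk m) / (1+qpPk m)) ^ (2*m+1) = 1 at h3
  have hz : qpPz m^2 = (qpPk m : ℂ) := by
    unfold qpPz; rw [mul_pow, Complex.I_sq, ← Complex.ofReal_pow, Real.sq_sqrt (by linarith)]; push_cast; ring
  have hre : 0 ≤ (qpPz m).re := by unfold qpPz; simp
  refine ⟨⟨hre, _, hz, h1, by linarith⟩, qpU_ok _ hre _ hz h1 (by linarith), ?_, ?_⟩
  · intro h0; rw [h0] at hz
    have : qpPk m = 0 := by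
      have h4 : (0:ℂ) = qpPk m := by rw [← hz]; simp
      exact_mod_cast h4.symm
    linarith
  · unfold qpB qpNQ; rw [hz]; exact_mod_cast h3

theorem qpPz_deriv (m : ℕ) : deriv qpT (qpPz m) ≠ 0 := by
  obtain ⟨-, h, h0, -⟩ := qpPz_ok m
  have h2 := (qp_exists_pole m).choose_spec.2.1
  change qpPk m < 0 at h2
  have s2 : √2 ^ 2 = 2 := Real.sq_sqrt (by norm_num)
  have := h.k1
  refine qpT_deriv h h0 (ne_of_gt ?_)
  have s1 : 1 < √2 := by rw [Real.lt_sqrt] <;> norm_num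
  nlinarith

theorem qpPz_inj : Function.Injective (fun m => qpT (qpPz m)) := by
  intro i j hij
  obtain ⟨-, hi, hi0, hib⟩ := qpPz_ok i
  obtain ⟨-, hj, hj0, hjb⟩ := qpPz_ok j
  have ki := (qp_exists_pole i).choose_spec.2.1
  change qpPk i < 0 at ki
  have kj := (qp_exists_pole j).choose_spec.2.1
  change qpPk j < 0 at kj
  have s2 : √2 ^ 2 = 2 := Real.sq_sqrt (by norm_num)
  have s1 : 1 < √2 := by rw [Real.lt_sqrt] <;> norm_num
  have s3 : √2 < 3/2 := by rw [Real.sqrt_lt'] <;> norm_num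
  have hsq : qpT (qpPz i)^2 = qpT (qpPz j)^2 := by
    have : qpT (qpPz i) = qpT (qpPz j) := hij
    rw [this]
  unfold qpT at hsq
  rw [div_pow, div_pow, qpNq_sq, qpNq_sq, div_eq_div_iff (pow_ne_zero _ hi.hQ1') (pow_ne_zero _ hj.hQ1')] at hsq
  have hfac : (qpNQ (qpPz i) - qpNQ (qpPz j)) * (1 - qpNQ (qpPz i) * qpNQ (qpPz j)) = 0 := by
    linear_combination hsq
  have hn : 1 - qpNQ (qpPz i) * qpNQ (qpPz j) ≠ 0 := by
    refine qp_ne _ _ le_rfl ?_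
    rw [norm_mul]
    have := hi.hQ1
    have := hj.hQ1
    nlinarith [norm_nonneg (qpNQ (qpPz i)), norm_nonneg (qpNQ (qpPz j))]
  have hQ : qpNQ (qpPz i) = qpNQ (qpPz j) := sub_eq_zero.1 ((mul_eq_zero.1 hfac).resolve_right hn)
  have hQr := hQ
  rw [hi.hQ, hj.hQ] at hQr
  have hQr' := Complex.ofReal_injective hQr
  have hki := hi.hk
  have hkj := hj.hk
  have k1i := hi.k1
  have k1j := hj.k1
  have hk : qpPk i = qpPk j := by
    rw [div_eq_div_iff hki.ne' hkj.ne'] at hQr'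
    have hf : (qpPk i - qpPk j) * (1 - qpPk i - qpPk j - qpPk i * qpPk j) = 0 := by linear_combination hQr'
    refine sub_eq_zero.1 ((mul_eq_zero.1 hf).resolve_right (ne_of_gt ?_))
    nlinarith
  have hb : qpB (qpPz i) = qpB (qpPz j) := by
    unfold qpB; rw [hi.hz, hj.hz, hk]
  rw [hb, hQ, ← hjb] at hib
  have hb0 : qpB (qpPz j) ≠ 0 := by intro h0; rw [h0] at hjb; simp at hjb
  have hp := mul_left_cancel₀ hb0 hib
  have hQ0 : qpNQ (qpPz j) ≠ 0 := by intro h0; rw [h0] at hjb; simp at hjb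
  have hp' := congrArg norm hp
  rw [norm_pow, norm_pow] at hp'
  have := pow_right_injective₀ (norm_pos_iff.2 hQ0) hj.hQ1.ne hp'
  omega

theorem modelD_not_DFinite :
    ¬ ∃ (r : ℕ) (p : ℕ → Polynomial ℚ),
      (∃ i, i ≤ r ∧ p i ≠ 0) ∧
      ∑ i ∈ Finset.range (r + 1),
        (p i : PowerSeries ℚ) *
          (PowerSeries.derivativeFun^[i] (walkGF ({(-1,1),(0,1),(1,-1)} : Finset (ℤ × ℤ)))) = 0 := by
  rintro ⟨r, p, ⟨i, hi, hpi⟩, hsum⟩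
  classical
  set F := walkGF ({(-1,1),(0,1),(1,-1)} : Finset (ℤ × ℤ)) with hFdef
  -- the largest index with nonzero coefficient
  set s := Nat.findGreatest (fun j => p j ≠ 0) r with hs
  have hps : p s ≠ 0 := Nat.findGreatest_spec (P := fun j => p j ≠ 0) hi hpi
  have hsr : s ≤ r := Nat.findGreatest_le r
  have hsum2 : ∑ i ∈ Finset.range (s + 1),
      (p i : PowerSeries ℚ) * (PowerSeries.derivativeFun^[i] F) = 0 := by
    rw [← hsum]
    apply Finset.sum_subset
    · intro j hj
      simp only [Finset.mem_range] at hj ⊢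
      omega
    · intro j hj hj2
      simp only [Finset.mem_range] at hj hj2
      have h0 : p j = 0 := by
        have := Nat.findGreatest_is_greatest (P := fun j => p j ≠ 0) (n := r) (k := j)
          (by omega) (by omega)
        simpa using this
      simp [h0]
  have hgood : qpGood F := qpGood_of_le qp_coeff_bound
  have hode := qp_ode hgood s p hsum2
  have hQ : ∀ t : ℂ, qpQ t 1 1 = qpEv F t := by
    intro t
    unfold qpQ qpEv
    refine tsum_congr fun n => ?_
    rw [hFdef, qpP_one]
  obtain ⟨hzU, hzok⟩ := qpZ0_ok
  have hz0 : qpZ0 ≠ 0 := by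
    intro h
    have h2 := hzok.hz
    rw [h] at h2
    have h3 := congrArg Complex.re h2
    rw [Complex.ofReal_re] at h3
    norm_num at h3
  refine qp_abstract (qpEv F) (fun z hz => (qpGood_diff hgood hz).2) s p hps hode qpT qpG qpU
    qpU_conn ?_ ?_ qpZ0 hzU ?_ ?_ ?_ (Set.range qpPz) ?_ ?_ ?_ ?_
  · rintro z ⟨h0, k, hk, k1, k2⟩
    exact qpG_mero (qpU_ok z h0 k hk k1 k2)
  · rintro z ⟨h0, k, hk, k1, k2⟩
    exact qpT_an (qpU_ok z h0 k hk k1 k2)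
  · simpa using qpZ0_base.1
  · exact qpT_deriv hzok hz0 (by norm_num)
  · refine qpZ0_base.2.trans (Eventually.of_forall fun z => ?_)
    exact hQ _
  · rintro _ ⟨m, rfl⟩
    exact (qpPz_ok m).1
  · rintro _ ⟨m, rfl⟩
    exact qpPz_deriv m
  · rintro _ ⟨m, rfl⟩
    obtain ⟨h1, h2, h3, h4⟩ := qpPz_ok m
    exact qp_pole h1 h2 h3 (2*m) h4
  · exact Set.infinite_of_injective_forall_mem qpPz_inj
      (fun m => ⟨qpPz m, ⟨m, rfl⟩, rfl⟩)
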